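/- Let R be a Gorenstein Noetherian local ring. The following are equivalent: (i) every Gorenstein flat R-module is flat; (ii) every balanced big Cohen–Macaulay R-module has finite flat dimension; (iii) every G–Gorenstein R-module is Gorenstein; (iv) R is regular. -/

import Mathlib

universe u

namespace GG

open RingTheory.Sequence

variable (R : Type u) [CommRing R]

/-- A module `N` is Gorenstein injective if it is a kernel in a `Hom(Inj,−)`-exact exact
doubly infinite complex of injective modules. -/
def IsGorensteinInjective (N : Type u) [AddCommGroup N] [Module R N] : Prop :=
  ∃ (X : ℤ → ModuleCat.{u} R) (d : ∀ n : ℤ, X n →ₗ[R] X (n + 1)),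
    (∀ n, Module.Injective R (X n)) ∧
    (∀ n, LinearMap.range (d n) = LinearMap.ker (d (n + 1))) ∧
    (∀ (I : ModuleCat.{u} R), Module.Injective R I →
      ∀ (n : ℤ) (φ : I →ₗ[R] X (n + 1)), (d (n + 1)).comp φ = 0 →
        ∃ ψ : I →ₗ[R] X n, (d n).comp ψ = φ) ∧
    Nonempty (N ≃ₗ[R] LinearMap.ker (d 0))

/-- A module `N` is Gorenstein projective if it is a kernel in a `Hom(−,Proj)`-exact exact
doubly infinite complex of projective modules. -/
def IsGorensteinProjective (N : Type u) [AddCommGroup N] [Module R N] : Prop :=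
  ∃ (X : ℤ → ModuleCat.{u} R) (d : ∀ n : ℤ, X n →ₗ[R] X (n + 1)),
    (∀ n, Module.Projective R (X n)) ∧
    (∀ n, LinearMap.range (d n) = LinearMap.ker (d (n + 1))) ∧
    (∀ (P : ModuleCat.{u} R), Module.Projective R P →
      ∀ (n : ℤ) (φ : X (n + 1) →ₗ[R] P), φ.comp (d n) = 0 →
        ∃ ψ : X (n + 1 + 1) →ₗ[R] P, ψ.comp (d (n + 1)) = φ) ∧
    Nonempty (N ≃ₗ[R] LinearMap.ker (d 0))

/-- A module `N` is Gorenstein flat if it is a kernel in an `(Inj ⊗ −)`-exact exact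
doubly infinite complex of flat modules. -/
def IsGorensteinFlat (N : Type u) [AddCommGroup N] [Module R N] : Prop :=
  ∃ (X : ℤ → ModuleCat.{u} R) (d : ∀ n : ℤ, X n →ₗ[R] X (n + 1)),
    (∀ n, Module.Flat R (X n)) ∧
    (∀ n, LinearMap.range (d n) = LinearMap.ker (d (n + 1))) ∧
    (∀ (I : ModuleCat.{u} R), Module.Injective R I →
      ∀ n : ℤ, LinearMap.range (LinearMap.lTensor (R := R) I (d n)) =
        LinearMap.ker (LinearMap.lTensor (R := R) I (d (n + 1)))) ∧
    Nonempty (N ≃ₗ[R] LinearMap.ker (d 0))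

/-- Existence of a right resolution of length `≤ n` by modules satisfying `P`. -/
def CoresolutionLE (P : ModuleCat.{u} R → Prop) (M : Type u) [AddCommGroup M] [Module R M]
    (n : ℕ) : Prop :=
  ∃ (G : ℕ → ModuleCat.{u} R) (d : ∀ i : ℕ, G i →ₗ[R] G (i + 1)) (ε : M →ₗ[R] G 0),
    (∀ i, P (G i)) ∧ Function.Injective ε ∧
    LinearMap.range ε = LinearMap.ker (d 0) ∧
    (∀ i, LinearMap.range (d i) = LinearMap.ker (d (i + 1))) ∧
    (∀ i, n < i → ∀ x : G i, x = 0)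

/-- Existence of a left resolution of length `≤ n` by modules satisfying `P`. -/
def ResolutionLE (P : ModuleCat.{u} R → Prop) (M : Type u) [AddCommGroup M] [Module R M]
    (n : ℕ) : Prop :=
  ∃ (G : ℕ → ModuleCat.{u} R) (d : ∀ i : ℕ, G (i + 1) →ₗ[R] G i) (ε : G 0 →ₗ[R] M),
    (∀ i, P (G i)) ∧ Function.Surjective ε ∧
    LinearMap.ker ε = LinearMap.range (d 0) ∧
    (∀ i, LinearMap.ker (d i) = LinearMap.range (d (i + 1))) ∧
    (∀ i, n < i → ∀ x : G i, x = 0)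

/-- `Gid_R M ≤ n`. -/
def gidLE (M : Type u) [AddCommGroup M] [Module R M] (n : ℕ) : Prop :=
  CoresolutionLE R (fun N => IsGorensteinInjective R N) M n

/-- `id_R M ≤ n`. -/
def idLE (M : Type u) [AddCommGroup M] [Module R M] (n : ℕ) : Prop :=
  CoresolutionLE R (fun N => Module.Injective R N) M n

/-- `pd_R M ≤ n`. -/
def pdLE (M : Type u) [AddCommGroup M] [Module R M] (n : ℕ) : Prop :=
  ResolutionLE R (fun N => Module.Projective R N) M n

/-- `fd_R M ≤ n`. -/
def fdLE (M : Type u) [AddCommGroup M] [Module R M] (n : ℕ) : Prop :=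
  ResolutionLE R (fun N => Module.Flat R N) M n

/-- `Gfd_R M ≤ n`. -/
def gfdLE (M : Type u) [AddCommGroup M] [Module R M] (n : ℕ) : Prop :=
  ResolutionLE R (fun N => IsGorensteinFlat R N) M n

/-- Gorenstein injective dimension, as an extended natural number. -/
noncomputable def gid (M : Type u) [AddCommGroup M] [Module R M] : ℕ∞ :=
  sInf {c : ℕ∞ | ∃ n : ℕ, c = n ∧ gidLE R M n}

/-- The depth of a module over a local ring: the supremum of the lengths of regular
sequences contained in the maximal ideal. -/
noncomputable def mdepth [IsLocalRing R] (M : Type u) [AddCommGroup M] [Module R M] : ℕ∞ :=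
  sSup {c : ℕ∞ | ∃ rs : List R, c = rs.length ∧
    (∀ r ∈ rs, r ∈ IsLocalRing.maximalIdeal R) ∧ RingTheory.Sequence.IsRegular M rs}

/-- The Krull dimension of a module: the Krull dimension of its support. -/
noncomputable def mdim (M : Type u) [AddCommGroup M] [Module R M] : WithBot ℕ∞ :=
  Order.krullDim ↥(Module.support R M)

/-- The height of a prime in the support of `M`. -/
noncomputable def htM (M : Type u) [AddCommGroup M] [Module R M] (p : PrimeSpectrum R) : ℕ∞ :=
  ⨆ h : p ∈ Module.support R M, Order.height (⟨p, h⟩ : ↥(Module.support R M))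

/-- A Cohen–Macaulay module over a local ring: depth equals Krull dimension. -/
def IsCMModule [IsLocalRing R] (M : Type u) [AddCommGroup M] [Module R M] : Prop :=
  (mdepth R M : WithBot ℕ∞) = mdim R M

/-- A maximal Cohen–Macaulay module over a local ring. -/
def IsMaximalCM [IsLocalRing R] (M : Type u) [AddCommGroup M] [Module R M] : Prop :=
  IsCMModule R M ∧ mdim R M = ringKrullDim R

/-- A Cohen–Macaulay local ring. -/
def IsCMLocalRing [IsLocalRing R] : Prop :=
  (mdepth R R : WithBot ℕ∞) = ringKrullDim R

/-- A Gorenstein local ring: a Noetherian local ring of finite self-injective dimension. -/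
def IsGorensteinLocalRing [IsLocalRing R] : Prop :=
  IsNoetherianRing R ∧ ∃ n : ℕ, idLE R R n

/-- A regular local ring: Noetherian, and the maximal ideal is generated by `dim R` elements. -/
def IsRegularLocal [IsLocalRing R] : Prop :=
  IsNoetherianRing R ∧ ∃ s : Finset R, Ideal.span (s : Set R) = IsLocalRing.maximalIdeal R ∧
    (s.card : WithBot ℕ∞) = ringKrullDim R

/-- A (not necessarily local) Gorenstein ring: all localizations at primes are Gorenstein. -/
def IsGorensteinRing : Prop :=
  ∀ p : PrimeSpectrum R, ∃ n : ℕ,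
    idLE (Localization.AtPrime p.asIdeal) (Localization.AtPrime p.asIdeal) n

/-- `R` admits a dualizing complex; by Kawasaki's theorem this is equivalent to being a
homomorphic image of a finite-dimensional Gorenstein ring. -/
def HasDualizingComplex : Prop :=
  ∃ Q : CommRingCat.{u}, IsNoetherianRing Q ∧ ringKrullDim Q < ⊤ ∧ IsGorensteinRing Q ∧
    ∃ f : Q →+* R, Function.Surjective f

section Cousin

/-- The product of the localizations of `N` at the primes in `S`. -/
noncomputable abbrev locProd (S : Set (PrimeSpectrum R)) (N : Type u) [AddCommGroup N]
    [Module R N] : Type u :=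
  Π p : S, LocalizedModule p.1.asIdeal.primeCompl N

/-- The submodule of the product of localizations consisting of finitely supported families;
this is the direct sum `⊕_{p ∈ S} N_p`. -/
noncomputable def finSupp (S : Set (PrimeSpectrum R)) (N : Type u) [AddCommGroup N]
    [Module R N] : Submodule R (locProd R S N) where
  carrier := {f | {p : S | f p ≠ 0}.Finite}
  add_mem' := by
    intro f g hf hg
    refine (hf.union hg).subset ?_
    intro p hp
    by_contra h
    simp only [Set.mem_union, Set.mem_setOf_eq, not_or, not_not] at h
    exact hp (by simp [Pi.add_apply, h.1, h.2])
  zero_mem' := by simp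
  smul_mem' := by
    intro c f hf
    refine hf.subset ?_
    intro p hp
    by_contra h
    simp only [Set.mem_setOf_eq, not_not] at h
    exact hp (by simp [Pi.smul_apply, h])

/-- The canonical map `N → ∏_{p ∈ S} N_p`. -/
noncomputable def thetaFull (S : Set (PrimeSpectrum R)) (N : Type u) [AddCommGroup N]
    [Module R N] : N →ₗ[R] locProd R S N :=
  LinearMap.pi fun p => LocalizedModule.mkLinearMap p.1.asIdeal.primeCompl N

/-- The cokernel of `N → ⊕_{p ∈ S} N_p` (computed inside the direct sum). -/
noncomputable abbrev nextKType (S : Set (PrimeSpectrum R)) (N : Type u) [AddCommGroup N]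
    [Module R N] : Type u :=
  ↥(finSupp R S N) ⧸
    (Submodule.comap (finSupp R S N).subtype (LinearMap.range (thetaFull R S N)))

/-- The sequence of "kernel/cokernel" modules in the inductive construction
of the Cousin complex of `M` with respect to the filtration `F`. -/
noncomputable def cousinK (F : ℕ → Set (PrimeSpectrum R)) (M : ModuleCat.{u} R) :
    ℕ → ModuleCat.{u} R
  | 0 => M
  | n + 1 => ModuleCat.of R (nextKType R (F n \ F (n + 1)) (cousinK F M n))

/-- The `n`-th term `M^n = ⊕_{p ∈ ∂F_n} (coker d^{n-2})_p` of the Cousin complex. -/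
noncomputable abbrev cousinC (F : ℕ → Set (PrimeSpectrum R)) (M : ModuleCat.{u} R) (n : ℕ) :
    Type u :=
  ↥(finSupp R (F n \ F (n + 1)) (cousinK R F M n))

/-- The canonical map from the `n`-th cokernel into the product of its localizations. -/
noncomputable def cousinTheta (F : ℕ → Set (PrimeSpectrum R)) (M : ModuleCat.{u} R) (n : ℕ) :
    (cousinK R F M n) →ₗ[R] locProd R (F n \ F (n + 1)) (cousinK R F M n) :=
  thetaFull R _ _

/-- The (full) `n`-th differential of the Cousin complex, from `M^n` to the product at
level `n+1` (it lands inside the direct sum `M^{n+1}`). -/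
noncomputable def cousinD (F : ℕ → Set (PrimeSpectrum R)) (M : ModuleCat.{u} R) (n : ℕ) :
    (cousinC R F M n) →ₗ[R] locProd R (F (n + 1) \ F (n + 2)) (cousinK R F M (n + 1)) :=
  (cousinTheta R F M (n + 1)).comp
    (Submodule.mkQ (Submodule.comap (finSupp R (F n \ F (n + 1)) (cousinK R F M n)).subtype
      (LinearMap.range (thetaFull R (F n \ F (n + 1)) (cousinK R F M n)))))

/-- `F` is a filtration of `Spec R`: descending, and every element of `∂F_n = F_n \ F_{n+1}`
is a minimal member of `F_n`. -/
def IsFiltration (F : ℕ → Set (PrimeSpectrum R)) : Prop :=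
  (∀ n, F (n + 1) ⊆ F n) ∧
    ∀ n, ∀ p ∈ F n \ F (n + 1), ∀ q ∈ F n, q ≤ p → q = p

/-- The filtration `F` admits `M`. -/
def Admits (F : ℕ → Set (PrimeSpectrum R)) (M : Type u) [AddCommGroup M] [Module R M] : Prop :=
  Module.support R M ⊆ F 0

/-- The `M`-height filtration `K_i = {p ∈ Supp M | ht_M p ≥ i}`. -/
noncomputable def heightFiltration (M : Type u) [AddCommGroup M] [Module R M] :
    ℕ → Set (PrimeSpectrum R) :=
  fun i => {p | p ∈ Module.support R M ∧ (i : ℕ∞) ≤ htM R M p}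

/-- The Cousin complex `C(F, M)` is exact at `M, M⁰, …, M^t`
(together with the well-definedness of the differentials into the direct sums). -/
def CousinPartiallyExact (F : ℕ → Set (PrimeSpectrum R)) (M : ModuleCat.{u} R) (t : ℕ) : Prop :=
  (∀ n, LinearMap.range (cousinTheta R F M n) ≤ finSupp R (F n \ F (n + 1)) (cousinK R F M n)) ∧
  Function.Injective (cousinTheta R F M 0) ∧
  (∀ n ≤ t, LinearMap.ker (cousinD R F M n) =
    Submodule.comap (finSupp R (F n \ F (n + 1)) (cousinK R F M n)).subtype
      (LinearMap.range (cousinTheta R F M n)))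

/-- The Cousin complex `C(F, M)` is exact and all of its terms satisfy `P`, i.e. it provides
a `P`-resolution of `M`. -/
def CousinResolves (F : ℕ → Set (PrimeSpectrum R)) (M : ModuleCat.{u} R)
    (P : ModuleCat.{u} R → Prop) : Prop :=
  (∀ n, LinearMap.range (cousinTheta R F M n) ≤ finSupp R (F n \ F (n + 1)) (cousinK R F M n)) ∧
  Function.Injective (cousinTheta R F M 0) ∧
  (∀ n, LinearMap.ker (cousinD R F M n) =
    Submodule.comap (finSupp R (F n \ F (n + 1)) (cousinK R F M n)).subtype
      (LinearMap.range (cousinTheta R F M n))) ∧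
  (∀ n, P (ModuleCat.of R (cousinC R F M n)))

/-- A G–Gorenstein module: a nonzero finitely generated module whose Cousin complex with
respect to the `M`-height filtration is a Gorenstein injective resolution. -/
def IsGGorenstein (M : ModuleCat.{u} R) : Prop :=
  (∃ x : M, x ≠ 0) ∧ Module.Finite R M ∧
    CousinResolves R (heightFiltration R M) M (fun N => IsGorensteinInjective R N)

/-- A Gorenstein module: a nonzero finitely generated module whose Cousin complex with
respect to the `M`-height filtration is an injective resolution. -/
def IsGorensteinModule (M : ModuleCat.{u} R) : Prop :=
  (∃ x : M, x ≠ 0) ∧ Module.Finite R M ∧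
    CousinResolves R (heightFiltration R M) M (fun N => Module.Injective R N)

end Cousin

/-- A system of parameters of a local ring. -/
def IsSOP [IsLocalRing R] (rs : List R) : Prop :=
  (rs.length : WithBot ℕ∞) = ringKrullDim R ∧
    (∀ r ∈ rs, r ∈ IsLocalRing.maximalIdeal R) ∧
    IsLocalRing.maximalIdeal R ≤ (Ideal.span {r | r ∈ rs}).radical

/-- A balanced big Cohen–Macaulay module: every system of parameters of `R` is a regular
sequence on `M`. -/
def IsBalancedBigCM [IsLocalRing R] (M : Type u) [AddCommGroup M] [Module R M] : Prop :=
  ∀ rs : List R, IsSOP R rs → RingTheory.Sequence.IsRegular M rs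

end GG

namespace GGP
open CategoryTheory CategoryTheory.Abelian

section ExtTools
variable {R : Type u} [CommRing R]

lemma shortExact_of {A B C : Type u} [AddCommGroup A] [AddCommGroup B] [AddCommGroup C]
    [Module R A] [Module R B] [Module R C] {f : A →ₗ[R] B} {g : B →ₗ[R] C}
    (hf : Function.Injective f) (hfg : Function.Exact f g) (hg : Function.Surjective g) :
    (ShortComplex.mk (ModuleCat.ofHom f) (ModuleCat.ofHom g)
      (by ext x; exact hfg.apply_apply_eq_zero x)).ShortExact where
  exact := (ShortComplex.ShortExact.moduleCat_exact_iff_function_exact _).2 hfg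
  mono_f := (ModuleCat.mono_iff_injective _).2 hf
  epi_g := (ModuleCat.epi_iff_surjective _).2 hg

/-- Every element of `Ext^i(N,Y)` is killed by an element of `S`. -/
def XS (S : Submonoid R) (N Y : Type u) [AddCommGroup N] [Module R N] [AddCommGroup Y] [Module R Y]
    (i : ℕ) : Prop :=
  ∀ e : Ext (ModuleCat.of R N) (ModuleCat.of R Y) i, ∃ s ∈ S, s • e = 0

variable (S : Submonoid R) {A B C N Y : Type u} [AddCommGroup A] [AddCommGroup B] [AddCommGroup C]
    [Module R A] [Module R B] [Module R C] [AddCommGroup N] [Module R N] [AddCommGroup Y]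
    [Module R Y] {f : A →ₗ[R] B} {g : B →ₗ[R] C}
    (hf : Function.Injective f) (hfg : Function.Exact f g) (hg : Function.Surjective g)

include hf hfg hg

lemma XS.contra_mid {i : ℕ} (h1 : XS S A Y i) (h3 : XS S C Y i) : XS S B Y i := by
  intro e
  obtain ⟨s, hs, h⟩ := h1 ((Ext.mk₀ (ModuleCat.ofHom f)).comp e (zero_add i))
  rw [← Ext.comp_smul] at h
  obtain ⟨c, hc⟩ := Ext.contravariant_sequence_exact₂ (shortExact_of hf hfg hg) _ _ h
  obtain ⟨t, ht, h'⟩ := h3 c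
  refine ⟨t * s, S.mul_mem ht hs, ?_⟩
  rw [mul_smul, ← hc, ← Ext.comp_smul, h', Ext.comp_zero]

lemma XS.contra_left {i : ℕ} (h2 : XS S B Y i) (h3 : XS S C Y (i + 1)) : XS S A Y i := by
  intro e
  obtain ⟨s, hs, h⟩ := h3 ((shortExact_of hf hfg hg).extClass.comp e (add_comm 1 i))
  rw [← Ext.comp_smul] at h
  obtain ⟨c, hc⟩ := Ext.contravariant_sequence_exact₁ (shortExact_of hf hfg hg) _ _ _ h
  obtain ⟨t, ht, h'⟩ := h2 c
  refine ⟨t * s, S.mul_mem ht hs, ?_⟩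
  rw [mul_smul, ← hc, ← Ext.comp_smul, h', Ext.comp_zero]

lemma XS.contra_right {i : ℕ} (h1 : XS S A Y i) (h2 : XS S B Y (i + 1)) : XS S C Y (i + 1) := by
  intro e
  obtain ⟨s, hs, h⟩ := h2 ((Ext.mk₀ (ModuleCat.ofHom g)).comp e (zero_add _))
  rw [← Ext.comp_smul] at h
  obtain ⟨c, hc⟩ := Ext.contravariant_sequence_exact₃ (shortExact_of hf hfg hg) _ _ h (add_comm 1 i)
  obtain ⟨t, ht, h'⟩ := h1 c
  refine ⟨t * s, S.mul_mem ht hs, ?_⟩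
  rw [mul_smul, ← hc, ← Ext.comp_smul, h', Ext.comp_zero]

lemma XS.cov_mid {i : ℕ} (h1 : XS S N A i) (h3 : XS S N C i) : XS S N B i := by
  intro e
  obtain ⟨s, hs, h⟩ := h3 (e.comp (Ext.mk₀ (ModuleCat.ofHom g)) (add_zero i))
  rw [← Ext.smul_comp] at h
  obtain ⟨c, hc⟩ := Ext.covariant_sequence_exact₂ _ (shortExact_of hf hfg hg) _ h
  obtain ⟨t, ht, h'⟩ := h1 c
  refine ⟨t * s, S.mul_mem ht hs, ?_⟩
  rw [mul_smul, ← hc, ← Ext.smul_comp, h', Ext.zero_comp]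

lemma XS.cov_left {i : ℕ} (h3 : XS S N C i) (h2 : XS S N B (i + 1)) : XS S N A (i + 1) := by
  intro e
  obtain ⟨s, hs, h⟩ := h2 (e.comp (Ext.mk₀ (ModuleCat.ofHom f)) (add_zero _))
  rw [← Ext.smul_comp] at h
  obtain ⟨c, hc⟩ := Ext.covariant_sequence_exact₁ _ (shortExact_of hf hfg hg) _ h rfl
  obtain ⟨t, ht, h'⟩ := h3 c
  refine ⟨t * s, S.mul_mem ht hs, ?_⟩
  rw [mul_smul, ← hc, ← Ext.smul_comp, h', Ext.zero_comp]

lemma XS.cov_right {i : ℕ} (h2 : XS S N B i) (h1 : XS S N A (i + 1)) : XS S N C i := by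
  intro e
  obtain ⟨s, hs, h⟩ := h1 (e.comp (shortExact_of hf hfg hg).extClass rfl)
  rw [← Ext.smul_comp] at h
  obtain ⟨c, hc⟩ := Ext.covariant_sequence_exact₃ _ (shortExact_of hf hfg hg) _ rfl h
  obtain ⟨t, ht, h'⟩ := h2 c
  refine ⟨t * s, S.mul_mem ht hs, ?_⟩
  rw [mul_smul, ← hc, ← Ext.smul_comp, h', Ext.zero_comp]

omit hf hfg hg

/-- `Ext^i(N,Y) = 0`. -/
def XZ (N Y : Type u) [AddCommGroup N] [Module R N] [AddCommGroup Y] [Module R Y]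
    (i : ℕ) : Prop := XS (⊥ : Submonoid R) N Y i

lemma XZ_iff {i : ℕ} : XZ (R := R) N Y i ↔
    ∀ e : Ext (ModuleCat.of R N) (ModuleCat.of R Y) i, e = 0 := by
  unfold XZ XS
  refine forall_congr' fun e => ⟨?_, fun h => ⟨1, one_mem _, by simp [h]⟩⟩
  rintro ⟨s, hs, h⟩
  rw [Submonoid.mem_bot] at hs
  simpa [hs] using h

lemma XZ.xs {i : ℕ} (h : XZ (R := R) N Y i) : XS S N Y i :=
  fun e => ⟨1, one_mem _, by simp [XZ_iff.1 h e]⟩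

lemma XS.xz_of_local [IsLocalRing R] {i : ℕ}
    (h : XS (IsLocalRing.maximalIdeal R).primeCompl N Y i) : XZ (R := R) N Y i := by
  rw [XZ_iff]
  intro e
  obtain ⟨s, hs, h⟩ := h e
  have : IsUnit s := by simpa [Ideal.primeCompl] using hs
  exact this.smul_eq_zero.1 h

lemma XZ_zero_iff : XZ (R := R) N Y 0 ↔ ∀ f : N →ₗ[R] Y, f = 0 := by
  rw [XZ_iff]
  constructor
  · intro h f
    have := h (Ext.mk₀ (ModuleCat.ofHom f))
    rw [Ext.mk₀_eq_zero_iff] at this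
    have := congrArg ModuleCat.Hom.hom this
    exact this
  · intro h e
    obtain ⟨φ, rfl⟩ := Ext.homEquiv₀.symm.surjective e
    have : φ = 0 := by ext1; exact h φ.hom
    simp [this]

lemma XS_zero_iff : XS (R := R) S N Y 0 ↔ ∀ f : N →ₗ[R] Y, ∃ s ∈ S, s • f = 0 := by
  constructor
  · intro h f
    obtain ⟨s, hs, h⟩ := h (Ext.mk₀ (ModuleCat.ofHom f))
    refine ⟨s, hs, ?_⟩
    rw [← Ext.mk₀_smul, Ext.mk₀_eq_zero_iff] at h
    exact congrArg ModuleCat.Hom.hom h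
  · intro h e
    obtain ⟨φ, rfl⟩ := Ext.homEquiv₀.symm.surjective e
    obtain ⟨s, hs, h⟩ := h φ.hom
    refine ⟨s, hs, ?_⟩
    have h' : s • φ = 0 := by ext1; exact h
    change s • Ext.mk₀ φ = 0
    rw [← Ext.mk₀_smul, h', Ext.mk₀_zero]

lemma XZ.of_injective [Module.Injective R Y] {i : ℕ} (hi : 1 ≤ i) : XZ (R := R) N Y i := by
  obtain ⟨i, rfl⟩ := Nat.exists_eq_add_of_le' hi
  have : Injective (ModuleCat.of R Y) := Module.injective_object_of_injective_module R Y
  exact XZ_iff.2 fun e => Ext.eq_zero_of_injective e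

lemma XZ.of_projective [Module.Projective R N] {i : ℕ} (hi : 1 ≤ i) : XZ (R := R) N Y i := by
  obtain ⟨i, rfl⟩ := Nat.exists_eq_add_of_le' hi
  have : Projective (ModuleCat.of R N) := (IsProjective.iff_projective N).1 inferInstance
  exact XZ_iff.2 fun e => Ext.eq_zero_of_projective e

lemma XS.congr {N' Y' : Type u} [AddCommGroup N'] [Module R N'] [AddCommGroup Y'] [Module R Y']
    (e1 : N ≃ₗ[R] N') (e2 : Y ≃ₗ[R] Y') {i : ℕ} (h : XS S N Y i) : XS S N' Y' i := by
  intro e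
  obtain ⟨s, hs, h⟩ := h (((Ext.mk₀ e1.toModuleIso.hom).comp e (zero_add i)).comp
    (Ext.mk₀ e2.toModuleIso.inv) (add_zero i))
  refine ⟨s, hs, ?_⟩
  have := congrArg (fun x => ((Ext.mk₀ e1.toModuleIso.inv).comp x (zero_add i)).comp
    (Ext.mk₀ e2.toModuleIso.hom) (add_zero i)) h
  have h1 : ModuleCat.ofHom (e1.symm : N' →ₗ[R] N) ≫ ModuleCat.ofHom (e1 : N →ₗ[R] N') = 𝟙 _ := by
    ext x; simp
  have h2 : ModuleCat.ofHom (e2.symm : Y' →ₗ[R] Y) ≫ ModuleCat.ofHom (e2 : Y →ₗ[R] Y') = 𝟙 _ := by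
    ext x; simp
  simp only [LinearEquiv.toModuleIso_inv, LinearEquiv.toModuleIso_hom, Ext.comp_smul, Ext.smul_comp,
    Ext.comp_zero, Ext.zero_comp] at this
  simpa [h1, h2] using this

lemma XZ.congr {N' Y' : Type u} [AddCommGroup N'] [Module R N'] [AddCommGroup Y'] [Module R Y']
    (e1 : N ≃ₗ[R] N') (e2 : Y ≃ₗ[R] Y') {i : ℕ} (h : XZ (R := R) N Y i) : XZ (R := R) N' Y' i :=
  XS.congr _ e1 e2 h

lemma XZ.of_subsingleton_left [Subsingleton N] {i : ℕ} : XZ (R := R) N Y i := by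
  rw [XZ_iff]
  intro e
  have : (𝟙 (ModuleCat.of R N)) = 0 := by ext x; exact Subsingleton.elim _ _
  rw [← Ext.mk₀_id_comp e, this, Ext.mk₀_zero, Ext.zero_comp]

lemma XZ.of_subsingleton_right [Subsingleton Y] {i : ℕ} : XZ (R := R) N Y i := by
  rw [XZ_iff]
  intro e
  have : (𝟙 (ModuleCat.of R Y)) = 0 := by ext x; exact Subsingleton.elim _ _
  rw [← Ext.comp_mk₀_id e, this, Ext.mk₀_zero, Ext.comp_zero]

include hf in
lemma XS.cov_mono (h : XS S N B 0) : XS S N A 0 := by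
  rw [XS_zero_iff] at *
  intro φ
  obtain ⟨s, hs, h⟩ := h (f.comp φ)
  refine ⟨s, hs, ?_⟩
  ext x
  apply hf
  simpa using LinearMap.congr_fun h x

include hf hfg hg in
/-- If `Ext^1(C, Y) = 0` then maps from `A` to `Y` extend to `B`. -/
lemma XZ.extend (h : XZ (R := R) C Y 1) (φ : A →ₗ[R] Y) : ∃ ψ : B →ₗ[R] Y, ψ.comp f = φ := by
  obtain ⟨x, hx⟩ := Ext.contravariant_sequence_exact₁ (shortExact_of hf hfg hg) _
    (Ext.mk₀ (ModuleCat.ofHom φ)) (add_comm 1 0) (XZ_iff.1 h _)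
  obtain ⟨ψ, rfl⟩ := Ext.homEquiv₀.symm.surjective x
  refine ⟨ψ.hom, ?_⟩
  change (Ext.mk₀ _).comp (Ext.mk₀ ψ) _ = _ at hx
  rw [Ext.mk₀_comp_mk₀] at hx
  have := Ext.homEquiv₀.symm.injective hx
  exact congrArg ModuleCat.Hom.hom this

include hf hfg hg in
/-- If `Ext^1(N, A) = 0` then maps from `N` to `C` lift to `B`. -/
lemma XZ.lift (h : XZ (R := R) N A 1) (φ : N →ₗ[R] C) : ∃ ψ : N →ₗ[R] B, g.comp ψ = φ := by
  obtain ⟨x, hx⟩ := Ext.covariant_sequence_exact₃ _ (shortExact_of hf hfg hg)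
    (Ext.mk₀ (ModuleCat.ofHom φ)) (zero_add 1) (XZ_iff.1 h _)
  obtain ⟨ψ, rfl⟩ := Ext.homEquiv₀.symm.surjective x
  refine ⟨ψ.hom, ?_⟩
  change (Ext.mk₀ ψ).comp (Ext.mk₀ _) _ = _ at hx
  rw [Ext.mk₀_comp_mk₀] at hx
  have := Ext.homEquiv₀.symm.injective hx
  exact congrArg ModuleCat.Hom.hom this

include hf hfg hg in
/-- Converse of `XZ.extend` when `B` is such that `Ext^1(B,Y)=0`. -/
lemma XZ.one_of_extend (hB : XZ (R := R) B Y 1)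
    (h : ∀ φ : A →ₗ[R] Y, ∃ ψ : B →ₗ[R] Y, ψ.comp f = φ) : XZ (R := R) C Y 1 := by
  rw [XZ_iff]
  intro e
  obtain ⟨x, hx⟩ := Ext.contravariant_sequence_exact₃ (shortExact_of hf hfg hg) _ e
    (XZ_iff.1 hB _) (add_comm 1 0)
  obtain ⟨φ, rfl⟩ := Ext.homEquiv₀.symm.surjective x
  obtain ⟨ψ, hψ⟩ := h φ.hom
  rw [← hx]
  have : φ = ModuleCat.ofHom f ≫ ModuleCat.ofHom ψ := by
    ext1; exact hψ.symm
  change _ = _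
  change (Ext.comp _ (Ext.mk₀ φ) _) = 0
  rw [this, ← Ext.mk₀_comp_mk₀, (shortExact_of hf hfg hg).extClass_comp_assoc]

end ExtTools
end GGP
set_option linter.unusedSectionVars false
namespace GGP
open CategoryTheory CategoryTheory.Abelian

section Nak
variable {R : Type u} [CommRing R]

lemma exists_uniform {E : Type*} [AddCommGroup E] [Module R E] [Module.Finite R E]
    (S : Submonoid R) (h : ∀ e : E, ∃ s ∈ S, s • e = 0) : ∃ s ∈ S, ∀ e : E, s • e = 0 := by
  classical
  choose s hs h using h
  obtain ⟨T, hT⟩ := Module.Finite.fg_top (R := R) (M := E)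
  refine ⟨∏ t ∈ T, s t, S.prod_mem fun t _ => hs t, fun e => ?_⟩
  have : e ∈ Submodule.span R (T : Set E) := hT ▸ trivial
  induction this using Submodule.span_induction with
  | mem x hx => rw [← Finset.prod_erase_mul _ _ hx, mul_smul, h, smul_zero]
  | zero => simp
  | add x y _ _ hx hy => rw [smul_add, hx, hy, add_zero]
  | smul a x _ hx => rw [smul_comm, hx, smul_zero]

lemma nak {E : Type*} [AddCommGroup E] [Module R E] [Module.Finite R E]
    (p : Ideal R) [p.IsPrime] {x : R} (hx : x ∈ p)
    (h : ∀ e : E, ∃ s ∈ p.primeCompl, ∃ e' : E, s • e = x • e') :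
    ∀ e : E, ∃ s ∈ p.primeCompl, s • e = 0 := by
  obtain ⟨s, hs, h1⟩ := exists_uniform (R := R) (E := E ⧸ (Ideal.span {x} • (⊤ : Submodule R E)))
    p.primeCompl (by
      intro e
      obtain ⟨e, rfl⟩ := Submodule.mkQ_surjective _ e
      obtain ⟨s, hs, e', h'⟩ := h e
      refine ⟨s, hs, ?_⟩
      rw [← map_smul, h', Submodule.mkQ_apply, Submodule.Quotient.mk_eq_zero]
      exact Submodule.smul_mem_smul (Ideal.mem_span_singleton_self x) trivial)
  obtain ⟨P, hP, -, hc, ha⟩ :=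
    LinearMap.exists_monic_and_natDegree_eq_and_coeff_mem_pow_and_aeval_eq_zero R
      (algebraMap R (Module.End R E) s) (Ideal.span {x}) (by
        rintro _ ⟨e, rfl⟩
        have := h1 (Submodule.mkQ _ e)
        rw [← map_smul, Submodule.mkQ_apply, Submodule.Quotient.mk_eq_zero] at this
        exact this)
  have hxp : Ideal.span {x} ≤ p := (Ideal.span_singleton_le_iff_mem p).2 hx
  intro e
  refine ⟨P.eval s, ?_, ?_⟩
  · have hm : P.map (Ideal.Quotient.mk p) = Polynomial.X ^ P.natDegree := by
      ext k
      rw [Polynomial.coeff_map, Polynomial.coeff_X_pow]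
      split_ifs with hk
      · rw [hk, hP.coeff_natDegree, map_one]
      · rcases lt_or_gt_of_ne hk with hk | hk
        · rw [Ideal.Quotient.eq_zero_iff_mem]
          exact hxp (Ideal.pow_le_self (by omega) (hc k))
        · rw [Polynomial.coeff_eq_zero_of_natDegree_lt hk, map_zero]
    intro h0
    have h2 : Ideal.Quotient.mk p (P.eval s) = 0 := Ideal.Quotient.eq_zero_iff_mem.2 h0
    rw [← Polynomial.eval_map_apply, hm, Polynomial.eval_pow, Polynomial.eval_X, ← map_pow,
      Ideal.Quotient.eq_zero_iff_mem] at h2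
    exact hs (Ideal.IsPrime.mem_of_pow_mem inferInstance _ h2)
  · rw [Polynomial.aeval_algebraMap_apply] at ha
    have := LinearMap.congr_fun ha e
    simpa using this

lemma smul_injective_quot (q : Ideal R) [q.IsPrime] {x : R} (hx : x ∉ q) :
    Function.Injective (LinearMap.lsmul R (R ⧸ q) x) := by
  rw [injective_iff_map_eq_zero]
  intro a ha
  obtain ⟨a, rfl⟩ := Ideal.Quotient.mk_surjective a
  have : Ideal.Quotient.mk q (x * a) = 0 := by
    rw [map_mul]; simpa [Algebra.smul_def] using ha
  rw [Ideal.Quotient.eq_zero_iff_mem] at this ⊢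
  exact (Ideal.IsPrime.mem_or_mem inferInstance this).resolve_left hx

lemma exact_quot (q : Ideal R) (x : R) :
    Function.Exact (LinearMap.lsmul R (R ⧸ q) x)
      (Submodule.factor (le_sup_left : q ≤ q ⊔ Ideal.span {x})) := by
  intro a
  obtain ⟨a, rfl⟩ := Ideal.Quotient.mk_surjective a
  constructor
  · intro h
    have h' : (Submodule.Quotient.mk a : R ⧸ (q ⊔ Ideal.span {x})) = 0 := h
    rw [Submodule.Quotient.mk_eq_zero, Submodule.mem_sup] at h'
    obtain ⟨y, hy, z, hz, rfl⟩ := h'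
    obtain ⟨c, rfl⟩ := Ideal.mem_span_singleton'.1 hz
    refine ⟨Ideal.Quotient.mk q c, ?_⟩
    rw [LinearMap.lsmul_apply, map_add, Ideal.Quotient.eq_zero_iff_mem.2 hy, zero_add, map_mul,
      Algebra.smul_def, mul_comm]
    rfl
  · rintro ⟨b, hb⟩
    obtain ⟨b, rfl⟩ := Ideal.Quotient.mk_surjective b
    rw [← hb]
    change (Submodule.Quotient.mk (x * b) : R ⧸ (q ⊔ Ideal.span {x})) = 0
    rw [Submodule.Quotient.mk_eq_zero]
    exact Ideal.mem_sup_right (Ideal.mul_mem_right _ _ (Ideal.mem_span_singleton_self x))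

variable [IsNoetherianRing R] {Y : Type u} [AddCommGroup Y] [Module R Y] [Module.Finite R Y]

lemma E3 (p : Ideal R) [p.IsPrime] {q : Ideal R} [q.IsPrime] {x : R} (hxq : x ∉ q) (hxp : x ∈ p)
    {i : ℕ} (h : XS p.primeCompl (R ⧸ (q ⊔ Ideal.span {x})) Y (i + 1)) :
    XS p.primeCompl (R ⧸ q) Y i := by
  have : Module.Finite R (Ext (ModuleCat.of R (R ⧸ q)) (ModuleCat.of R Y) i) :=
    ModuleCat.finite_ext _ _ _ _
  refine nak p hxp fun e => ?_
  have SE := shortExact_of (smul_injective_quot q hxq) (exact_quot q x)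
    (Submodule.factor_surjective _)
  obtain ⟨s, hs, h⟩ := h (SE.extClass.comp e (add_comm 1 i))
  rw [← Ext.comp_smul] at h
  obtain ⟨c, hc⟩ := Ext.contravariant_sequence_exact₁ SE _ _ _ h
  refine ⟨s, hs, c, ?_⟩
  rw [← hc]
  have : ModuleCat.ofHom (LinearMap.lsmul R (R ⧸ q) x) = x • 𝟙 (ModuleCat.of R (R ⧸ q)) := by
    ext1; rfl
  change (Ext.mk₀ (ModuleCat.ofHom (LinearMap.lsmul R (R ⧸ q) x))).comp c _ = _
  rw [this, Ext.mk₀_smul, Ext.smul_comp, Ext.mk₀_id_comp]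

lemma ann_quot (q : Ideal R) : Module.annihilator R (R ⧸ q) = q := Ideal.annihilator_quotient

omit [Module.Finite R Y] in
lemma E4 (S : Submonoid R) {i : ℕ} (N : Type u) [AddCommGroup N] [Module R N] [hN : Module.Finite R N]
    (h : ∀ q : Ideal R, q.IsPrime → Module.annihilator R N ≤ q → XS S (R ⧸ q) Y i) :
    XS S N Y i := by
  revert h
  induction hN using IsNoetherianRing.induction_on_isQuotientEquivQuotientPrime R with
  | subsingleton N => exact fun _ => XZ.xs _ (XZ.of_subsingleton_left)
  | quotient N p f =>
    intro h
    refine XS.congr _ f.symm (LinearEquiv.refl R Y) (h p.1 p.2 ?_)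
    rw [f.annihilator_eq, ann_quot]
  | exact N₁ N₂ N₃ f g hf hg hfg h1 h3 =>
    intro h
    refine XS.contra_mid S hf hfg hg (h1 fun q hq h' => h q hq (le_trans ?_ h'))
      (h3 fun q hq h' => h q hq (le_trans ?_ h'))
    · exact f.annihilator_le_of_injective hf
    · exact g.annihilator_le_of_surjective hg

omit [Module.Finite R Y] in
/-- `XS` holds when an element of `S` kills `N`. -/
lemma XS.of_mem_ann (S : Submonoid R) {i : ℕ} (N : Type u) [AddCommGroup N] [Module R N]
    {s : R} (hs : s ∈ S) (hN : s ∈ Module.annihilator R N) : XS S N Y i := by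
  intro e
  refine ⟨s, hs, ?_⟩
  have : s • 𝟙 (ModuleCat.of R N) = 0 := by
    ext x; exact Module.mem_annihilator.1 hN x
  rw [← Ext.mk₀_id_comp e, ← Ext.smul_comp, ← Ext.mk₀_smul, this, Ext.mk₀_zero, Ext.zero_comp]

end Nak
end GGP
set_option linter.unusedSectionVars false
namespace GGP
open CategoryTheory CategoryTheory.Abelian RingTheory.Sequence

/-- finite self-injective dimension, in terms of `Ext`. -/
def FID (R : Type u) [CommRing R] (Y : Type u) [AddCommGroup Y] [Module R Y] (n : ℕ) : Prop :=
  ∀ (N : Type u) [AddCommGroup N] [Module R N] (i : ℕ), n < i → XZ (R := R) N Y i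

lemma FID.of_idLE {R : Type u} [CommRing R] {Y : Type u} [AddCommGroup Y] [Module R Y] {n : ℕ}
    (h : GG.idLE R Y n) : FID R Y n := by
  obtain ⟨G, d, ε, hG, hε, h0, hd, hz⟩ := h
  have key : ∀ (N : Type u) [AddCommGroup N] [Module R N] (i j : ℕ), n < j + i →
      XZ (R := R) N (LinearMap.ker (d j)) i := by
    intro N _ _ i
    induction i with
    | zero =>
      intro j hj
      have : Subsingleton (LinearMap.ker (d j)) := by
        refine ⟨fun a b => Subtype.ext ?_⟩
        rw [hz j (by omega) a.1, hz j (by omega) b.1]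
      exact XZ.of_subsingleton_right
    | succ i ih =>
      intro j hj
      have := hG j
      refine XS.cov_left _ (f := (LinearMap.ker (d j)).subtype)
        (g := (d j).codRestrict (LinearMap.ker (d (j + 1)))
          (fun x => by rw [← hd j]; exact ⟨x, rfl⟩)) (Submodule.injective_subtype _) ?_ ?_
        (ih (j + 1) (by omega)) (XZ.of_injective (by omega))
      · intro x
        simp [Subtype.ext_iff]
      · rintro ⟨y, hy⟩
        rw [← hd j] at hy
        obtain ⟨x, rfl⟩ := hy
        exact ⟨x, rfl⟩
  intro N _ _ i hi
  have e : Y ≃ₗ[R] LinearMap.ker (d 0) :=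
    (LinearEquiv.ofInjective ε hε).trans (LinearEquiv.ofEq _ _ h0)
  exact XZ.congr (LinearEquiv.refl R N) e.symm (key N i 0 (by omega))

variable {R : Type u} [CommRing R]

lemma XZ.subsingleton {N Y : Type u} [AddCommGroup N] [Module R N] [AddCommGroup Y] [Module R Y]
    {i : ℕ} (h : XZ (R := R) N Y i) : Subsingleton (Ext (ModuleCat.of R N) (ModuleCat.of R Y) i) :=
  ⟨fun a b => by rw [XZ_iff.1 h a, XZ_iff.1 h b]⟩

lemma XZ.of_subsingleton_ext {N Y : Type u} [AddCommGroup N] [Module R N] [AddCommGroup Y]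
    [Module R Y] {i : ℕ} (h : Subsingleton (Ext (ModuleCat.of R N) (ModuleCat.of R Y) i)) :
    XZ (R := R) N Y i := XZ_iff.2 fun _ => Subsingleton.elim _ _

lemma XS.mono {S T : Submonoid R} (hST : S ≤ T) {N Y : Type u} [AddCommGroup N] [Module R N]
    [AddCommGroup Y] [Module R Y] {i : ℕ} (h : XS S N Y i) : XS T N Y i := fun e =>
  let ⟨s, hs, h⟩ := h e
  ⟨s, hST hs, h⟩

variable [IsNoetherianRing R]

lemma exists_prime_lt {q : Ideal R} [q.IsPrime] {h : ℕ} (hq : q.height = (h + 1 : ℕ)) :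
    ∃ p : Ideal R, p.IsPrime ∧ p < q ∧ p.height = h := by
  have : ¬ q.height ≤ h := by
    rw [hq]; norm_cast; omega
  rw [Ideal.height_le_iff] at this
  push Not at this
  obtain ⟨p, hp, hpq, hh⟩ := this
  refine ⟨p, hp, hpq, le_antisymm ?_ hh⟩
  have := Ideal.height_add_one_le_of_lt_of_isPrime hpq
  rw [hq] at this
  push_cast at this
  exact (ENat.add_le_add_iff_right (by simp)).1 this

lemma H1 (h : ℕ) : ∀ (q : Ideal R) [q.IsPrime], q.height = h →
    ¬ XS q.primeCompl (R ⧸ q) R h := by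
  induction h with
  | zero =>
    intro q _ hq hx
    have h1 : q ∈ minimalPrimes R := Ideal.height_eq_zero_iff.1 (by simpa using hq)
    have h2 : q ∈ associatedPrimes R R := by
      apply Module.associatedPrimes.minimalPrimes_annihilator_subset_associatedPrimes
      have : Module.annihilator R R = ⊥ := Module.annihilator_eq_bot.2 inferInstance
      rw [this]; exact h1
    obtain ⟨_, f, hf⟩ := (isAssociatedPrime_iff_exists_injective_linearMap _ _).1 h2
    obtain ⟨s, hs, h⟩ := (XS_zero_iff _).1 hx f
    have : f (Ideal.Quotient.mk q s) = 0 := by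
      have := LinearMap.congr_fun h (Ideal.Quotient.mk q 1)
      rw [LinearMap.smul_apply, ← map_smul] at this
      have e : s • Ideal.Quotient.mk q 1 = Ideal.Quotient.mk q s := by
        rw [Algebra.smul_def]; simp
      rw [e] at this
      simpa using this
    rw [map_eq_zero_iff f hf, Ideal.Quotient.eq_zero_iff_mem] at this
    exact hs this
  | succ h ih =>
    intro q _ hq hx
    obtain ⟨p, hp, hpq, hph⟩ := exists_prime_lt hq
    obtain ⟨x, hxq, hxp⟩ := SetLike.exists_of_lt hpq
    refine ih p hph (XS.mono ?_ (E3 q hxp hxq (E4 _ _ ?_) (i := h) (Y := R)))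
    · intro s hs hs'; exact hs (hpq.le hs')
    · intro r hr hle
      rw [ann_quot] at hle
      by_cases hrq : r ≤ q
      · have : p < r := by
          refine lt_of_le_of_ne (le_sup_left.trans hle) ?_
          rintro rfl
          exact hxp (hle (Ideal.mem_sup_right (Ideal.mem_span_singleton_self x)))
        have h1 := Ideal.height_add_one_le_of_lt_of_isPrime this
        have h2 : r = q := by
          refine Ideal.eq_of_le_of_height_le _ hrq ?_
          rw [hq]; rw [hph] at h1; exact_mod_cast h1
        subst h2
        exact hx
      · obtain ⟨s, hs, hs'⟩ := SetLike.not_le_iff_exists.1 hrq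
        exact XS.of_mem_ann _ _ (s := s) hs' (by rwa [ann_quot])

/-- Descending induction. -/
lemma Desc {n : ℕ} (hR : FID R R n) (p : Ideal R) [p.IsPrime] (t : ℕ) (L : Type u)
    [AddCommGroup L] [Module R L] [Module.Finite R L] (f : (R ⧸ p) →ₗ[R] L)
    (hf : Function.Injective f) (hL : ∀ j, t < j → XS p.primeCompl L R j) :
    ∀ j, t < j → ∀ (N : Type u) [AddCommGroup N] [Module R N] [Module.Finite R N],
      XS p.primeCompl N R j := by
  suffices H : ∀ c j, n < j + c → t < j → ∀ (N : Type u) [AddCommGroup N] [Module R N]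
      [Module.Finite R N], XS p.primeCompl N R j from fun j hj => H (n + 1) j (by omega) hj
  intro c
  induction c with
  | zero =>
    intro j hj _ N _ _ _
    exact XZ.xs _ (hR N j hj)
  | succ c ih =>
    intro j hj htj N _ _ _
    refine E4 _ _ fun q hq _ => ?_
    by_cases hqp : q ≤ p
    · rcases hqp.eq_or_lt with rfl | hlt
      · exact XS.contra_left _ hf (LinearMap.exact_map_mkQ_range f) (Submodule.mkQ_surjective _)
          (hL j htj) (ih (j + 1) (by omega) (by omega) _)
      · obtain ⟨x, hxp, hxq⟩ := SetLike.exists_of_lt hlt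
        exact E3 p hxq hxp (ih (j + 1) (by omega) (by omega) _)
    · obtain ⟨s, hs, hs'⟩ := SetLike.not_le_iff_exists.1 hqp
      exact XS.of_mem_ann _ _ (s := s) hs' (by rwa [ann_quot])

variable [IsLocalRing R]

lemma XZ_quot_regular {rs : List R} (h : IsRegular R rs) {Y : Type u} [AddCommGroup Y] [Module R Y]
    {j : ℕ} (hj : rs.length < j) : XZ (R := R) (R ⧸ Ideal.ofList rs) Y j := by
  have h1 := ModuleCat.projectiveDimension_quotient_eq_length.{u} rs h
  have h2 := (projectiveDimension_le_iff _ _).1 h1.le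
  refine XZ.congr (Shrink.linearEquiv.{u} R (R ⧸ Ideal.ofList rs)) (LinearEquiv.refl R Y)
    (XZ_iff.2 fun e => ?_)
  exact Abelian.Ext.eq_zero_of_hasProjectiveDimensionLT e (rs.length + 1) (by omega)

lemma supp_quot (p : Ideal R) :
    Module.support R (R ⧸ p) = PrimeSpectrum.zeroLocus p := by
  rw [Module.support_eq_zeroLocus, ann_quot]

lemma smul_top_lt {p : Ideal R} (hp : p ≤ IsLocalRing.maximalIdeal R) (M : Type u) [AddCommGroup M]
    [Module R M] [Module.Finite R M] [Nontrivial M] : p • (⊤ : Submodule R M) < ⊤ := by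
  rw [lt_top_iff_ne_top]
  intro h
  exact top_ne_bot (Submodule.eq_bot_of_le_smul_of_le_jacobson_bot p ⊤ Module.Finite.fg_top h.ge
    (hp.trans (IsLocalRing.maximalIdeal_le_jacobson _)))

lemma rees {p : Ideal R} (hp : p ≤ IsLocalRing.maximalIdeal R) {n : ℕ} {M : Type u} [AddCommGroup M]
    [Module R M] [Module.Finite R M] [Nontrivial M]
    (h : ∀ i < n, XZ (R := R) (R ⧸ p) M i) :
    ∃ rs : List R, rs.length = n ∧ (∀ r ∈ rs, r ∈ p) ∧ IsRegular M rs :=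
  ModuleCat.exists_isRegular_of_exists_subsingleton_ext p n (ModuleCat.of R M)
    (smul_top_lt hp M) (ModuleCat.of R (R ⧸ p)) (supp_quot p) fun i hi => (h i hi).subsingleton

lemma rees' {p : Ideal R} (hp : p ≤ IsLocalRing.maximalIdeal R) {rs : List R}
    (hrs : ∀ r ∈ rs, r ∈ p) {M : Type u} [AddCommGroup M] [Module R M] [Module.Finite R M]
    (h : IsRegular M rs) : ∀ i < rs.length, XZ (R := R) (R ⧸ p) M i := by
  have : Nontrivial M := h.nontrivial
  exact fun i hi => XZ.of_subsingleton_ext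
    (ModuleCat.subsingleton_ext_of_exists_isRegular p (ModuleCat.of R (R ⧸ p))
    (supp_quot p).le (ModuleCat.of R M) (smul_top_lt hp M) rs hrs h i hi)

end GGP
set_option linter.unusedSectionVars false
namespace GGP
open CategoryTheory CategoryTheory.Abelian RingTheory.Sequence IsLocalRing

variable {R : Type u} [CommRing R] [IsNoetherianRing R] [IsLocalRing R]

lemma isSOP_mem_ofList {rs : List R} {p : Ideal R} (h : ∀ r ∈ rs, r ∈ p) : Ideal.ofList rs ≤ p := by
  rw [Ideal.ofList, Ideal.span_le]; exact h

lemma isRegular_append_singleton {rs : List R} {M : Type u} [AddCommGroup M] [Module R M]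
    [Module.Finite R M]
    (h : IsRegular M rs) {r : R} (hr : IsRegular (M ⧸ (Ideal.ofList rs • ⊤ : Submodule R M)) [r])
    (hrs : ∀ r ∈ rs, r ∈ maximalIdeal R) (hrm : r ∈ maximalIdeal R) : IsRegular M (rs ++ [r]) := by
  have := h.nontrivial
  refine ⟨(isWeaklyRegular_append_iff M rs [r]).2 ⟨h.1, hr.1⟩, ?_⟩
  refine (smul_top_lt (p := Ideal.ofList (rs ++ [r])) (isSOP_mem_ofList ?_) M).ne'
  intro x hx
  rw [List.mem_append] at hx
  rcases hx with hx | hx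
  · exact hrs x hx
  · rw [List.mem_singleton.1 hx]; exact hrm

lemma H2 {n : ℕ} (hR : FID R R n) {d : ℕ} (hd : (maximalIdeal R).height = d) :
    ∀ i < d, XZ (R := R) (R ⧸ maximalIdeal R) R i := by
  classical
  have hex : ∃ t, ¬ XZ (R := R) (R ⧸ maximalIdeal R) R t :=
    ⟨d, fun h => H1 d _ hd (XZ.xs _ h)⟩
  have ht := Nat.find_spec hex
  have hlt : ∀ i < Nat.find hex, XZ (R := R) (R ⧸ maximalIdeal R) R i := fun i hi => by
    simpa using Nat.find_min hex hi
  set t := Nat.find hex with htdef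
  suffices d ≤ t from fun i hi => hlt i (by omega)
  obtain ⟨rs, hlen, hmem, hreg⟩ := rees le_rfl hlt
  have hsoc : ¬ XZ (R := R) (R ⧸ maximalIdeal R) (R ⧸ (Ideal.ofList rs • ⊤ : Submodule R R)) 0 := by
    intro h0
    have : Nontrivial (R ⧸ (Ideal.ofList rs • ⊤ : Submodule R R)) :=
      Submodule.Quotient.nontrivial_iff.2 hreg.2.symm
    obtain ⟨l, hl, hl', hlr⟩ := rees (R := R) (n := 1) (M := R ⧸ (Ideal.ofList rs • ⊤ : Submodule R R))
      le_rfl (fun i hi => by obtain rfl : i = 0 := by omega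
                             exact h0)
    obtain ⟨r, rfl⟩ := List.length_eq_one_iff.1 hl
    have hrm : r ∈ maximalIdeal R := hl' r (by simp)
    have := isRegular_append_singleton hreg hlr hmem hrm
    refine ht (rees' le_rfl ?_ this t (by simp [hlen]))
    intro x hx
    rw [List.mem_append] at hx
    rcases hx with hx | hx
    · exact hmem x hx
    · rw [List.mem_singleton.1 hx]; exact hrm
  rw [XZ_zero_iff] at hsoc
  push Not at hsoc
  obtain ⟨f, hf⟩ := hsoc
  have hinj : Function.Injective f := by
    letI := Ideal.Quotient.field (maximalIdeal R)
    rw [injective_iff_map_eq_zero]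
    intro a ha
    by_contra ha0
    apply hf
    ext
    have : (Ideal.Quotient.mk (maximalIdeal R) 1) = a⁻¹ * a := by
      rw [inv_mul_cancel₀ ha0]; rfl
    obtain ⟨b, hb⟩ := Ideal.Quotient.mk_surjective a⁻¹
    have h2 : a⁻¹ * a = b • a := by rw [← hb, Algebra.smul_def]; rfl
    change f (Ideal.Quotient.mk (maximalIdeal R) 1) = 0
    rw [this, h2, map_smul, ha, smul_zero]
  by_contra hcon
  refine H1 d _ hd (Desc hR (maximalIdeal R) t _ f hinj ?_ d (by omega) _)
  intro j hj
  have := XZ_quot_regular hreg (Y := R) (j := j) (by omega)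
  have e : (R ⧸ Ideal.ofList rs) ≃ₗ[R] (R ⧸ (Ideal.ofList rs • ⊤ : Submodule R R)) :=
    Submodule.quotEquivOfEq _ _ (by simp)
  exact XZ.xs _ (XZ.congr e (LinearEquiv.refl R R) this)

lemma H3 {n : ℕ} (hR : FID R R n) (q : Ideal R) : q.IsPrime → ∀ i : ℕ, (i : ℕ∞) < q.height →
    XZ (R := R) (R ⧸ q) R i := by
  induction q using WellFoundedGT.induction with
  | ind q ih =>
    intro hq i hi
    by_cases hqm : q = maximalIdeal R
    · subst hqm
      obtain ⟨d, hd⟩ := ENat.ne_top_iff_exists.1 (Ideal.height_ne_top_of_isPrime (I := maximalIdeal R))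
      refine H2 hR hd.symm i ?_
      rw [← hd] at hi
      exact_mod_cast hi
    · have hlt : q < maximalIdeal R := lt_of_le_of_ne (le_maximalIdeal hq.ne_top) hqm
      obtain ⟨x, hxm, hxq⟩ := SetLike.exists_of_lt hlt
      refine XS.xz_of_local (E3 (maximalIdeal R) hxq hxm (E4 _ _ fun r hr hle => XZ.xs _ ?_))
      rw [ann_quot] at hle
      have hqr : q < r := by
        refine lt_of_le_of_ne (le_sup_left.trans hle) ?_
        rintro rfl
        exact hxq (hle (Ideal.mem_sup_right (Ideal.mem_span_singleton_self x)))
      refine ih r hqr hr (i + 1) ?_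
      refine lt_of_lt_of_le ?_ (Ideal.height_add_one_le_of_lt_of_isPrime hqr)
      push_cast
      exact (ENat.add_lt_add_iff_right (by simp)).2 hi

lemma H4 {n : ℕ} (hR : FID R R n) (p : Ideal R) [p.IsPrime] {h : ℕ} (hp : p.height = h) :
    ∀ j, h < j → ∀ (N : Type u) [AddCommGroup N] [Module R N] [Module.Finite R N],
      XS p.primeCompl N R j := by
  have hpm : p ≤ maximalIdeal R := le_maximalIdeal Ideal.IsPrime.ne_top'
  obtain ⟨rs, hlen, hmem, hreg⟩ := rees hpm (n := h) (M := R)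
    (fun i hi => H3 hR p inferInstance i (by rw [hp]; exact_mod_cast hi))
  have hass : p ∈ associatedPrimes R (R ⧸ Ideal.ofList rs) := by
    apply Module.associatedPrimes.minimalPrimes_annihilator_subset_associatedPrimes
    rw [ann_quot]
    refine ⟨⟨inferInstance, isSOP_mem_ofList hmem⟩, ?_⟩
    rintro r ⟨hr, hrr⟩ hrp
    have hh : p.height ≤ r.height := by
      by_contra hcon
      push Not at hcon
      rw [hp] at hcon
      obtain ⟨e, he⟩ := ENat.ne_top_iff_exists.1 hcon.ne_top
      rw [← he] at hcon
      have hcon : e < h := by exact_mod_cast hcon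
      refine H1 e r he.symm (XZ.xs _ (rees' (hrp.trans hpm) ?_ hreg e (by omega)))
      exact fun x hx => hrr (Ideal.subset_span hx)
    exact (Ideal.eq_of_le_of_height_le _ hrp hh).ge
  obtain ⟨_, f, hf⟩ := (isAssociatedPrime_iff_exists_injective_linearMap _ _).1 hass
  exact Desc hR p h _ f hf fun j hj => XZ.xs _ (XZ_quot_regular hreg (by omega))

lemma H4' {n : ℕ} (hR : FID R R n) {d : ℕ} (hd : (maximalIdeal R).height = d) (j : ℕ) (hj : d < j)
    (N : Type u) [AddCommGroup N] [Module R N] [Module.Finite R N] : XZ (R := R) N R j :=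
  XS.xz_of_local (H4 hR (maximalIdeal R) hd j hj N)

lemma H5 {n : ℕ} (hR : FID R R n) {d : ℕ} (hd : (maximalIdeal R).height = d) (ys : List R)
    (hys : ∀ y ∈ ys, y ∈ maximalIdeal R) : ∀ (p : Ideal R), p.IsPrime →
      maximalIdeal R ≤ (p ⊔ Ideal.ofList ys).radical → ∀ i, i + ys.length < d →
      XZ (R := R) (R ⧸ p) R i := by
  induction ys with
  | nil =>
    intro p hp hle i hi
    have : p = maximalIdeal R := by
      refine le_antisymm (le_maximalIdeal hp.ne_top) ?_
      simpa [hp.radical] using hle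
    subst this
    exact H2 hR hd i (by simpa using hi)
  | cons y ys ih =>
    intro p hp hle i hi
    have ih := ih fun z hz => hys z (by simp [hz])
    rw [Ideal.ofList_cons] at hle
    simp only [List.length_cons] at hi
    by_cases hy : y ∈ p
    · refine ih p hp (hle.trans (Ideal.radical_mono ?_)) i (by omega)
      refine sup_le le_sup_left (sup_le ?_ le_sup_right)
      rw [Ideal.span_singleton_le_iff_mem]
      exact Ideal.mem_sup_left hy
    · refine XS.xz_of_local (E3 (maximalIdeal R) hy (hys y (by simp))
        (E4 _ _ fun r hr hle' => XZ.xs _ ?_))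
      rw [ann_quot] at hle'
      refine ih r hr (hle.trans (Ideal.radical_mono ?_)) (i + 1) (by omega)
      rw [← sup_assoc]
      exact sup_le_sup_right hle' _

end GGP
set_option linter.unusedSectionVars false
namespace GGP
open CategoryTheory CategoryTheory.Abelian RingTheory.Sequence IsLocalRing

/-- finite projective dimension in terms of `Ext` -/
def FPD (R : Type u) [CommRing R] (M : Type u) [AddCommGroup M] [Module R M] (n : ℕ) : Prop :=
  ∀ (Y : Type u) [AddCommGroup Y] [Module R Y] (i : ℕ), n < i → XZ (R := R) M Y i

/-- finitely generated, and `Ext^i(M,R)=0` for `i>0`. -/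
def GP (R : Type u) [CommRing R] (M : Type u) [AddCommGroup M] [Module R M] : Prop :=
  Module.Finite R M ∧ ∀ i, 1 ≤ i → XZ (R := R) M R i

/-- A short exact sequence `0 → M → R^b → M' → 0`. -/
def Step (R : Type u) [CommRing R] (M M' : Type u) [AddCommGroup M] [Module R M]
    [AddCommGroup M'] [Module R M'] : Prop :=
  ∃ (b : ℕ) (f : M →ₗ[R] (Fin b → R)) (g : (Fin b → R) →ₗ[R] M'), Function.Injective f ∧
    Function.Exact f g ∧ Function.Surjective g

section
variable {R : Type u} [CommRing R] [IsNoetherianRing R]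

lemma Step.exists_prev (M' : Type u) [AddCommGroup M'] [Module R M'] [Module.Finite R M'] :
    ∃ M : ModuleCat.{u} R, Module.Finite R M ∧ Step R M M' := by
  obtain ⟨b, π, hπ⟩ := Module.Finite.exists_fin' R M'
  refine ⟨ModuleCat.of R (LinearMap.ker π), ?_, b, (LinearMap.ker π).subtype, π,
    Submodule.injective_subtype _, ?_, hπ⟩
  · change Module.Finite R (LinearMap.ker π); infer_instance
  · exact LinearMap.exact_subtype_ker_map π

lemma Step.xz_iff {M M' : Type u} [AddCommGroup M] [Module R M]
    [AddCommGroup M'] [Module R M'] (h : Step R M M') {Y : Type u} [AddCommGroup Y] [Module R Y]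
    {i : ℕ} (hi : 1 ≤ i) : XZ (R := R) M' Y (i + 1) ↔ XZ (R := R) M Y i := by
  obtain ⟨b, f, g, hf, hfg, hg⟩ := h
  exact ⟨fun h => XS.contra_left _ hf hfg hg (XZ.of_projective hi) h,
    fun h => XS.contra_right _ hf hfg hg h (XZ.of_projective (by omega))⟩

lemma exists_syz (d : ℕ) (M : Type u) [AddCommGroup M] [Module R M] [Module.Finite R M] :
    ∃ K : ModuleCat.{u} R, Module.Finite R K ∧
      ∀ (Y : Type u) [AddCommGroup Y] [Module R Y] (i : ℕ), 1 ≤ i →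
        (XZ (R := R) M Y (i + d) ↔ XZ (R := R) K Y i) := by
  induction d with
  | zero => exact ⟨ModuleCat.of R M, by assumption, fun Y _ _ i _ => Iff.rfl⟩
  | succ d ih =>
    obtain ⟨K, hK, h⟩ := ih
    obtain ⟨K', hK', hs⟩ := Step.exists_prev (R := R) K
    refine ⟨K', hK', fun Y _ _ i hi => ?_⟩
    rw [← hs.xz_iff hi, ← h Y (i + 1) (by omega)]
    rw [show i + (d + 1) = i + 1 + d by omega]

lemma GP.prev {M M' : Type u} [AddCommGroup M] [Module R M]
    [AddCommGroup M'] [Module R M'] (h : Step R M M') (hM : Module.Finite R M) (hG : GP R M') :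
    GP R M := ⟨hM, fun i hi => (h.xz_iff hi).1 (hG.2 (i + 1) (by omega))⟩

lemma dual_ses {M M' : Type u} [AddCommGroup M] [Module R M]
    [AddCommGroup M'] [Module R M'] {P : Type u} [AddCommGroup P] [Module R P]
    {f : M →ₗ[R] P} {g : P →ₗ[R] M'} (hf : Function.Injective f)
    (hfg : Function.Exact f g) (hg : Function.Surjective g) (h : XZ (R := R) M' R 1) :
    Function.Injective (LinearMap.lcomp R R g) ∧
      Function.Exact (LinearMap.lcomp R R g) (LinearMap.lcomp R R f) ∧
      Function.Surjective (LinearMap.lcomp R R f) := by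
  refine ⟨?_, ?_, fun φ => ?_⟩
  · intro a b hab
    ext x
    obtain ⟨y, rfl⟩ := hg x
    exact LinearMap.congr_fun hab y
  · intro φ
    constructor
    · intro hφ
      refine ⟨(LinearMap.range f).liftQ φ ?_ ∘ₗ
        (hfg.linearEquivOfSurjective hg).symm.toLinearMap, ?_⟩
      · rintro _ ⟨x, rfl⟩
        exact LinearMap.congr_fun hφ x
      · ext x
        have : (hfg.linearEquivOfSurjective hg).symm (g x) = Submodule.Quotient.mk x := by
          rw [LinearEquiv.symm_apply_eq]; rfl
        simp [this]
    · rintro ⟨ψ, rfl⟩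
      ext x
      simp [hfg.apply_apply_eq_zero]
  · obtain ⟨ψ, hψ⟩ := h.extend hf hfg hg φ
    exact ⟨ψ, hψ⟩

lemma GP.dual_xz {n : ℕ} (hR : FID R R n) : ∀ (c i : ℕ), 1 ≤ i → n < i + c →
    ∀ (M : Type u) [AddCommGroup M] [Module R M], GP R M → XZ (R := R) (M →ₗ[R] R) R i := by
  intro c
  induction c with
  | zero => intro i _ hi M _ _ _; exact hR _ _ hi
  | succ c ih =>
    intro i h1 hi M _ _ hM
    have := hM.1
    obtain ⟨K, hK, hs⟩ := Step.exists_prev (R := R) M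
    have hKG := hM.prev hs hK
    obtain ⟨b, f, g, hf, hfg, hg⟩ := hs
    obtain ⟨h2, h3, h4⟩ := dual_ses hf hfg hg (hM.2 1 le_rfl)
    have : Module.Projective R ((Fin b → R) →ₗ[R] R) := inferInstance
    exact XS.contra_left _ h2 h3 h4 (XZ.of_projective h1) (ih (i + 1) (by omega) (by omega) K hKG)

lemma GP.bidual_surj {n : ℕ} (hR : FID R R n) (M : Type u) [AddCommGroup M] [Module R M]
    (hM : GP R M) (ψ : (M →ₗ[R] R) →ₗ[R] R) : ∃ x : M, ∀ φ : M →ₗ[R] R, ψ φ = φ x := by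
  have := hM.1
  obtain ⟨K, hK, hs⟩ := Step.exists_prev (R := R) M
  have hKG := hM.prev hs hK
  obtain ⟨b, f, g, hf, hfg, hg⟩ := hs
  obtain ⟨h2, h3, h4⟩ := dual_ses hf hfg hg (hM.2 1 le_rfl)
  obtain ⟨ψ', hψ'⟩ := (GP.dual_xz hR (n + 1) 1 le_rfl (by omega) K hKG).extend h2 h3 h4 ψ
  obtain ⟨y, hy⟩ := (Module.bijective_dual_eval R (Fin b → R)).2 ψ'
  refine ⟨g y, fun φ => ?_⟩
  rw [← hψ', ← hy]
  rfl

lemma GP.torsionless {n : ℕ} (hR : FID R R n) (M : Type u) [AddCommGroup M] [Module R M]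
    (hM : GP R M) (x : M) (hx : ∀ φ : M →ₗ[R] R, φ x = 0) : x = 0 := by
  have := hM.1
  obtain ⟨K, hK, hs⟩ := Step.exists_prev (R := R) M
  have hKG := hM.prev hs hK
  obtain ⟨b, f, g, hf, hfg, hg⟩ := hs
  obtain ⟨h2, h3, h4⟩ := dual_ses hf hfg hg (hM.2 1 le_rfl)
  obtain ⟨y, rfl⟩ := hg x
  let ψ : (K →ₗ[R] R) →ₗ[R] R :=
    (LinearMap.range (LinearMap.lcomp R R g)).liftQ (Module.Dual.eval R _ y) (by
      rintro _ ⟨φ, rfl⟩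
      exact hx φ) ∘ₗ (h3.linearEquivOfSurjective h4).symm.toLinearMap
  have hψ : ∀ φ : (Fin b → R) →ₗ[R] R, ψ (φ.comp f) = φ y := by
    intro φ
    have : (h3.linearEquivOfSurjective h4).symm (φ.comp f) = Submodule.Quotient.mk φ := by
      rw [LinearEquiv.symm_apply_eq]; rfl
    simp [ψ, this]
  obtain ⟨z, hz⟩ := GP.bidual_surj hR K hKG ψ
  have : y = f z := by
    ext i
    have := hz ((LinearMap.proj i).comp f)
    rw [hψ] at this
    exact this
  rw [this, hfg.apply_apply_eq_zero]

lemma GP.next {n : ℕ} (hR : FID R R n) (M : Type u) [AddCommGroup M] [Module R M]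
    (hM : GP R M) : ∃ M' : ModuleCat.{u} R, GP R M' ∧ Step R M M' := by
  have := hM.1
  obtain ⟨b, φ, hφ⟩ := Module.Finite.exists_fin (R := R) (M := M →ₗ[R] R)
  let f : M →ₗ[R] (Fin b → R) := LinearMap.pi φ
  have hf : Function.Injective f := by
    rw [injective_iff_map_eq_zero]
    intro x hx
    refine GP.torsionless hR M hM x fun ψ => ?_
    have : ψ ∈ Submodule.span R (Set.range φ) := hφ ▸ trivial
    induction this using Submodule.span_induction with
    | mem ψ h => obtain ⟨i, rfl⟩ := h; exact congrFun hx i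
    | zero => simp
    | add a b _ _ ha hb => simp [ha, hb]
    | smul a b _ hb => simp [hb]
  have hext : ∀ ψ : M →ₗ[R] R, ∃ ψ' : (Fin b → R) →ₗ[R] R, ψ'.comp f = ψ := by
    intro ψ
    have : ψ ∈ Submodule.span R (Set.range φ) := hφ ▸ trivial
    induction this using Submodule.span_induction with
    | mem ψ h => obtain ⟨i, rfl⟩ := h; exact ⟨LinearMap.proj i, rfl⟩
    | zero => exact ⟨0, by simp⟩
    | add a b _ _ ha hb =>
      obtain ⟨a', rfl⟩ := ha
      obtain ⟨b', rfl⟩ := hb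
      exact ⟨a' + b', LinearMap.add_comp _ _ _⟩
    | smul a b _ hb =>
      obtain ⟨b', rfl⟩ := hb
      exact ⟨a • b', LinearMap.smul_comp _ _ _⟩
  have hex := LinearMap.exact_map_mkQ_range f
  have hsurj := Submodule.mkQ_surjective (LinearMap.range f)
  have hstep : Step R M ((Fin b → R) ⧸ LinearMap.range f) := ⟨b, f, _, hf, hex, hsurj⟩
  refine ⟨ModuleCat.of R ((Fin b → R) ⧸ LinearMap.range f), ⟨?_, ?_⟩, hstep⟩
  · change Module.Finite R ((Fin b → R) ⧸ LinearMap.range f); infer_instance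
  · intro i hi
    rcases hi.eq_or_lt with rfl | hi
    · exact XZ.one_of_extend hf hex hsurj (XZ.of_projective le_rfl) hext
    · obtain ⟨i, rfl⟩ := Nat.exists_eq_add_of_le' (show 1 ≤ i by omega)
      exact (hstep.xz_iff (by omega)).2 (hM.2 i (by omega))

end

lemma exists_int_seq {α : Type*} (r : α → α → Prop) (h1 : ∀ a, ∃ b, r a b) (h2 : ∀ b, ∃ a, r a b)
    (a : α) : ∃ s : ℤ → α, s 0 = a ∧ ∀ n, r (s n) (s (n + 1)) := by
  choose nx hnx using h1
  choose pv hpv using h2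
  refine ⟨fun n => match n with
    | Int.ofNat k => nx^[k] a
    | Int.negSucc k => pv^[k + 1] a, rfl, fun n => ?_⟩
  match n with
  | Int.ofNat k =>
    change r (nx^[k] a) (nx^[k + 1] a)
    rw [Function.iterate_succ_apply']
    exact hnx _
  | Int.negSucc 0 => exact hpv _
  | Int.negSucc (k + 1) =>
    change r (pv^[k + 1 + 1] a) (pv^[k + 1] a)
    rw [Function.iterate_succ_apply' pv (k + 1)]
    exact hpv _

lemma GP.seq {R : Type u} [CommRing R] [IsNoetherianRing R] {n : ℕ} (hR : FID R R n)
    (M : ModuleCat.{u} R) (hM : GP R M) : ∃ s : ℤ → ModuleCat.{u} R, s 0 = M ∧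
      (∀ n, GP R (s n)) ∧ ∀ n, Step R (s n) (s (n + 1)) := by
  obtain ⟨s, h0, hs⟩ := exists_int_seq (α := {M : ModuleCat.{u} R // GP R M})
    (fun M M' => Step R M.1 M'.1)
    (fun M => by
      obtain ⟨M', h, h'⟩ := GP.next hR M.1 M.2
      exact ⟨⟨M', h⟩, h'⟩)
    (fun M => by
      have := M.2.1
      obtain ⟨K, hK, hs⟩ := Step.exists_prev (R := R) M.1
      exact ⟨⟨K, M.2.prev hs hK⟩, hs⟩) ⟨M, hM⟩
  exact ⟨fun n => (s n).1, by simp [h0], fun n => (s n).2, hs⟩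

end GGP
set_option linter.unusedSectionVars false
namespace GGP
open IsLocalRing TensorProduct

section
variable {R : Type u} [CommRing R]

lemma inj_of_equiv {M N : Type u} [AddCommGroup M] [Module R M] [AddCommGroup N] [Module R N]
    (e : M ≃ₗ[R] N) (h : Module.Injective R M) : Module.Injective R N :=
  (Module.Baer.of_equiv e (Module.Baer.iff_injective.2 h)).injective

lemma inj_extend {A B E : Type u} [AddCommGroup A] [Module R A] [AddCommGroup B] [Module R B]
    [AddCommGroup E] [Module R E] (hE : Module.Injective R E) (f : A →ₗ[R] B)
    (hf : Function.Injective f) (φ : A →ₗ[R] E) : ∃ ψ : B →ₗ[R] E, ψ.comp f = φ := by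
  obtain ⟨ψ, hψ⟩ := hE.out f hf φ
  exact ⟨ψ, LinearMap.ext hψ⟩

section basisStuff
variable {N : Type u} [AddCommGroup N] [Module R N] {b : ℕ}

lemma exists_sum_single (t : N ⊗[R] (Fin b → R)) : ∃ h : Fin b → N,
    t = ∑ i, h i ⊗ₜ[R] (Pi.single i 1 : Fin b → R) := by
  induction t using TensorProduct.induction_on with
  | zero => exact ⟨0, by simp⟩
  | tmul n v =>
    refine ⟨fun i => v i • n, ?_⟩
    conv_lhs => rw [pi_eq_sum_univ' v, TensorProduct.tmul_sum]
    refine Finset.sum_congr rfl fun i _ => ?_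
    rw [TensorProduct.smul_tmul]
  | add x y hx hy =>
    obtain ⟨h, rfl⟩ := hx
    obtain ⟨k, rfl⟩ := hy
    exact ⟨h + k, by simp [TensorProduct.add_tmul, Finset.sum_add_distrib]⟩

noncomputable def coordT (N : Type u) [AddCommGroup N] [Module R N] (i : Fin b) :
    N ⊗[R] (Fin b → R) →ₗ[R] N :=
  (TensorProduct.rid R N).toLinearMap ∘ₗ LinearMap.lTensor N (LinearMap.proj i)

lemma coordT_sum (h : Fin b → N) (j : Fin b) :
    coordT N j (∑ i, h i ⊗ₜ[R] (Pi.single i 1 : Fin b → R)) = h j := by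
  simp [coordT, Pi.single_apply]

end basisStuff

variable {A I : Type u} [AddCommGroup A] [Module R A] [AddCommGroup I] [Module R I]

/-- `Hom(A,I) ⊗ M → Hom(Hom(M,A),I)`. -/
noncomputable def th (A I M : Type u) [AddCommGroup A] [Module R A] [AddCommGroup I] [Module R I]
    [AddCommGroup M] [Module R M] :
    (A →ₗ[R] I) ⊗[R] M →ₗ[R] ((M →ₗ[R] A) →ₗ[R] I) :=
  TensorProduct.lift (LinearMap.mk₂ R (fun h m => h ∘ₗ LinearMap.applyₗ m)
    (by intros; ext; simp) (by intros; ext; simp) (by intros; ext; simp) (by intros; ext; simp))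

lemma th_tmul {M : Type u} [AddCommGroup M] [Module R M] (h : A →ₗ[R] I) (m : M) (φ : M →ₗ[R] A) :
    th A I M (h ⊗ₜ m) φ = h (φ m) := rfl

lemma th_nat {M N : Type u} [AddCommGroup M] [Module R M] [AddCommGroup N] [Module R N]
    (a : M →ₗ[R] N) (t : (A →ₗ[R] I) ⊗[R] M) (φ : N →ₗ[R] A) :
    th A I N (LinearMap.lTensor _ a t) φ = th A I M t (φ ∘ₗ a) := by
  induction t using TensorProduct.induction_on with
  | zero => simp
  | tmul h m => simp [th_tmul]
  | add x y hx hy => simp [hx, hy]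

lemma th_free_bij (b : ℕ) : Function.Bijective (th (R := R) A I (Fin b → R)) := by
  constructor
  · rw [injective_iff_map_eq_zero]
    intro t ht
    obtain ⟨h, rfl⟩ := exists_sum_single t
    have : ∀ i, h i = 0 := by
      intro i
      ext a
      have := LinearMap.congr_fun ht (LinearMap.toSpanSingleton R A a ∘ₗ LinearMap.proj i)
      simp only [map_sum, LinearMap.sum_apply, th_tmul] at this
      rw [Finset.sum_eq_single i] at this
      · simpa using this
      · intro j _ hj
        simp [Pi.single_apply, hj.symm]
      · simp
    simp [this]
  · intro w
    refine ⟨∑ i, (w ∘ₗ (LinearMap.lcomp R A (LinearMap.proj i)) ∘ₗ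
      (LinearMap.ringLmapEquivSelf R R A).symm.toLinearMap) ⊗ₜ (Pi.single i 1), ?_⟩
    ext φ
    simp only [map_sum, LinearMap.sum_apply, th_tmul]
    simp only [LinearMap.comp_apply]
    rw [← map_sum]
    congr 1
    ext i
    simp [Pi.single_apply]

lemma L1 [IsNoetherianRing R] (hI : Module.Injective R I) (M : Type u) [AddCommGroup M] [Module R M]
    [Module.Finite R M] : Function.Injective (th (R := R) A I M) := by
  obtain ⟨K, hK, b, f, g, hf, hfg, hg⟩ := Step.exists_prev (R := R) M
  obtain ⟨c, a, ha⟩ := Module.Finite.exists_fin' R K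
  rw [injective_iff_map_eq_zero]
  intro t ht
  obtain ⟨y, rfl⟩ := LinearMap.lTensor_surjective (A →ₗ[R] I) hg t
  -- `th y` vanishes on maps factoring through `g`
  have hker : LinearMap.ker (LinearMap.lcomp R A (f ∘ₗ a)) ≤
      LinearMap.ker (th A I (Fin b → R) y) := by
    intro φ hφ
    have hφ' : φ ∘ₗ f = 0 := by
      ext x
      obtain ⟨x, rfl⟩ := ha x
      exact LinearMap.congr_fun hφ x
    have : ∃ ψ : M →ₗ[R] A, ψ ∘ₗ g = φ := by
      refine ⟨(LinearMap.range f).liftQ φ ?_ ∘ₗ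
        (hfg.linearEquivOfSurjective hg).symm.toLinearMap, ?_⟩
      · rintro _ ⟨x, rfl⟩
        exact LinearMap.congr_fun hφ' x
      · refine LinearMap.ext fun x => ?_
        have : (hfg.linearEquivOfSurjective hg).symm (g x) = Submodule.Quotient.mk x := by
          rw [LinearEquiv.symm_apply_eq]; rfl
        simp [this]
    obtain ⟨ψ, rfl⟩ := this
    rw [LinearMap.mem_ker, ← th_nat, ht]
    rfl
  obtain ⟨w, hw⟩ : ∃ w : ((Fin c → R) →ₗ[R] A) →ₗ[R] I,
      w ∘ₗ (LinearMap.lcomp R A (f ∘ₗ a)) = th A I (Fin b → R) y := by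
    obtain ⟨w, hw⟩ := inj_extend hI ((LinearMap.ker (LinearMap.lcomp R A (f ∘ₗ a))).liftQ _ le_rfl)
      (by rw [← LinearMap.ker_eq_bot, Submodule.ker_liftQ_eq_bot]; exact le_rfl)
      ((LinearMap.ker (LinearMap.lcomp R A (f ∘ₗ a))).liftQ _ hker)
    refine ⟨w, ?_⟩
    ext φ
    exact LinearMap.congr_fun hw (Submodule.Quotient.mk φ)
  obtain ⟨w', rfl⟩ := (th_free_bij c).2 w
  have : y = LinearMap.lTensor _ (f ∘ₗ a) w' := by
    apply (th_free_bij b).1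
    ext φ
    rw [th_nat, ← hw]
    rfl
  rw [this, LinearMap.lTensor_comp, LinearMap.comp_apply, ← LinearMap.comp_apply,
    ← LinearMap.lTensor_comp, hfg.linearMap_comp_eq_zero]
  simp

lemma L1_extend [IsNoetherianRing R] (hI : Module.Injective R I) {M P : Type u} [AddCommGroup M]
    [Module R M] [Module.Finite R M] [AddCommGroup P] [Module R P] (f : M →ₗ[R] P)
    (h : ∀ φ : M →ₗ[R] A, ∃ ψ : P →ₗ[R] A, ψ ∘ₗ f = φ) :
    Function.Injective (LinearMap.lTensor (A →ₗ[R] I) f) := by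
  rw [injective_iff_map_eq_zero]
  intro t ht
  apply L1 hI M
  ext φ
  obtain ⟨ψ, rfl⟩ := h φ
  rw [← th_nat, ht]
  simp

lemma flat_hom [IsNoetherianRing R] (hA : Module.Injective R A) (hI : Module.Injective R I) :
    Module.Flat R (A →ₗ[R] I) := by
  rw [Module.Flat.iff_lTensor_injective]
  intro J _
  exact L1_extend hI _ fun φ => inj_extend hA _ (Submodule.injective_subtype J) φ

lemma L1_extend' [IsNoetherianRing R] (hI : Module.Injective R I) {M P : Type u} [AddCommGroup M]
    [Module R M] [Module.Finite R M] [AddCommGroup P] [Module R P] (f : M →ₗ[R] P)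
    (h : ∀ φ : M →ₗ[R] R, ∃ ψ : P →ₗ[R] R, ψ ∘ₗ f = φ) :
    Function.Injective (LinearMap.lTensor I f) := by
  have h1 := L1_extend hI f h
  have e := LinearMap.ringLmapEquivSelf R R I
  have : LinearMap.lTensor I f ∘ₗ (LinearMap.rTensor M e.toLinearMap) =
      LinearMap.rTensor P e.toLinearMap ∘ₗ LinearMap.lTensor (R →ₗ[R] I) f := by
    ext; simp
  have h2 : Function.Injective (LinearMap.lTensor I f ∘ₗ (LinearMap.rTensor M e.toLinearMap)) := by
    rw [this]
    exact (e.rTensor P).injective.comp h1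
  intro x y hxy
  obtain ⟨x, rfl⟩ := (e.rTensor M).surjective x
  obtain ⟨y, rfl⟩ := (e.rTensor M).surjective y
  exact congrArg _ (h2 hxy)

end
end GGP
set_option linter.unusedSectionVars false
namespace GGP
open IsLocalRing TensorProduct

section
variable {R : Type u} [CommRing R]

lemma range_eq_ker_of_splice {X0 K1 X1 K2 X2 : Type*} [AddCommGroup X0] [Module R X0]
    [AddCommGroup K1] [Module R K1] [AddCommGroup X1] [Module R X1] [AddCommGroup K2] [Module R K2]
    [AddCommGroup X2] [Module R X2] (g0 : X0 →ₗ[R] K1) (f1 : K1 →ₗ[R] X1) (g1 : X1 →ₗ[R] K2)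
    (f2 : K2 →ₗ[R] X2) (h0 : Function.Surjective g0) (h1 : Function.Exact f1 g1)
    (h2 : Function.Injective f2) :
    LinearMap.range (f1 ∘ₗ g0) = LinearMap.ker (f2 ∘ₗ g1) := by
  rw [LinearMap.range_comp_of_range_eq_top _ (LinearMap.range_eq_top.2 h0),
    LinearMap.ker_comp_of_ker_eq_bot _ (LinearMap.ker_eq_bot.2 h2), h1.linearMap_ker_eq]

lemma equiv_ker_of_splice {K0 X0 K1 X1 : Type*} [AddCommGroup X0] [Module R X0]
    [AddCommGroup K1] [Module R K1] [AddCommGroup X1] [Module R X1] [AddCommGroup K0] [Module R K0]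
    (f0 : K0 →ₗ[R] X0) (g0 : X0 →ₗ[R] K1) (f1 : K1 →ₗ[R] X1)
    (h : Function.Injective f0) (h1 : Function.Exact f0 g0)
    (h2 : Function.Injective f1) :
    Nonempty (K0 ≃ₗ[R] LinearMap.ker (f1 ∘ₗ g0)) :=
  ⟨(LinearEquiv.ofInjective f0 h).trans (LinearEquiv.ofEq _ _ (by
    rw [LinearMap.ker_comp_of_ker_eq_bot _ (LinearMap.ker_eq_bot.2 h2), h1.linearMap_ker_eq]))⟩

/-- the data of a complete resolution. -/
structure CR (R : Type u) [CommRing R] (M : Type u) [AddCommGroup M] [Module R M] where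
  s : ℤ → ModuleCat.{u} R
  e0 : M ≃ₗ[R] s 0
  gp : ∀ n, GP R (s n)
  b : ℤ → ℕ
  f : ∀ n, s n →ₗ[R] (Fin (b n) → R)
  g : ∀ n, (Fin (b n) → R) →ₗ[R] s (n + 1)
  hf : ∀ n, Function.Injective (f n)
  hfg : ∀ n, Function.Exact (f n) (g n)
  hg : ∀ n, Function.Surjective (g n)

variable [IsNoetherianRing R]

lemma GP.cr {n : ℕ} (hR : FID R R n) (M : Type u) [AddCommGroup M] [Module R M] (hM : GP R M) :
    Nonempty (CR R M) := by
  obtain ⟨s, h0, hs, hst⟩ := GP.seq hR (ModuleCat.of R M) hM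
  choose b f g hf hfg hg using hst
  exact ⟨⟨s, (CategoryTheory.eqToIso h0.symm).toLinearEquiv, hs, b, f, g, hf, hfg, hg⟩⟩

/-- property `A(Y)`: tensoring with `Y` preserves injectivity of embeddings with cokernel in G. -/
def PA (R : Type u) [CommRing R] (Y : Type u) [AddCommGroup Y] [Module R Y] : Prop :=
  ∀ (M M' : Type u) [AddCommGroup M] [Module R M] [AddCommGroup M'] [Module R M'] (b : ℕ)
    (f : M →ₗ[R] (Fin b → R)) (g : (Fin b → R) →ₗ[R] M'), Function.Injective f →
    Function.Exact f g → Function.Surjective g → GP R M → GP R M' →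
    Function.Injective (LinearMap.lTensor Y f)

lemma PA.of_injective {I : Type u} [AddCommGroup I] [Module R I] (hI : Module.Injective R I) :
    PA R I := by
  intro M M' _ _ _ _ b f g hf hfg hg hM hM'
  have := hM.1
  exact L1_extend' hI f fun φ => (hM'.2 1 le_rfl).extend hf hfg hg φ

lemma PA.of_subsingleton {I : Type u} [AddCommGroup I] [Module R I] [Subsingleton I] :
    PA R I := by
  intro M M' _ _ _ _ b f g hf hfg hg hM hM'
  exact Function.injective_of_subsingleton _

/-- `B`: tensoring with `M` in `G` preserves an embedding `Y → E` when the cokernel satisfies `A`. -/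
lemma PA.tensor_injective {Y E Y' : Type u} [AddCommGroup Y] [Module R Y] [AddCommGroup E]
    [Module R E] [AddCommGroup Y'] [Module R Y'] {i : Y →ₗ[R] E} {p : E →ₗ[R] Y'}
    (hi : Function.Injective i) (hip : Function.Exact i p) (hp : Function.Surjective p)
    (hA : PA R Y') (M : Type u) [AddCommGroup M] [Module R M] (hM : GP R M) :
    Function.Injective (LinearMap.rTensor M i) := by
  have := hM.1
  obtain ⟨K, hK, hs⟩ := Step.exists_prev (R := R) M
  have hKG := hM.prev hs hK
  obtain ⟨b, f, g, hf, hfg, hg⟩ := hs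
  have hinj := hA K M b f g hf hfg hg hKG hM
  have comm1 : ∀ w, LinearMap.rTensor M i (LinearMap.lTensor Y g w) =
      LinearMap.lTensor E g (LinearMap.rTensor _ i w) := fun w => by
    rw [← LinearMap.comp_apply, ← LinearMap.comp_apply, LinearMap.rTensor_comp_lTensor,
      LinearMap.lTensor_comp_rTensor]
  have comm2 : ∀ w, LinearMap.rTensor _ p (LinearMap.lTensor E f w) =
      LinearMap.lTensor Y' f (LinearMap.rTensor _ p w) := fun w => by
    rw [← LinearMap.comp_apply, ← LinearMap.comp_apply, LinearMap.rTensor_comp_lTensor,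
      LinearMap.lTensor_comp_rTensor]
  have comm3 : ∀ w, LinearMap.rTensor _ i (LinearMap.lTensor Y f w) =
      LinearMap.lTensor E f (LinearMap.rTensor _ i w) := fun w => by
    rw [← LinearMap.comp_apply, ← LinearMap.comp_apply, LinearMap.rTensor_comp_lTensor,
      LinearMap.lTensor_comp_rTensor]
  rw [injective_iff_map_eq_zero]
  intro z hz
  obtain ⟨w, rfl⟩ := LinearMap.lTensor_surjective Y hg z
  rw [comm1] at hz
  obtain ⟨v, hv⟩ := (lTensor_exact E hfg hg _).1 hz
  have hv0 : LinearMap.rTensor _ p v = 0 := by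
    apply hinj
    rw [← comm2, hv, map_zero]
    exact (rTensor_exact _ hip hp).apply_apply_eq_zero w
  obtain ⟨v', rfl⟩ := (rTensor_exact _ hip hp _).1 hv0
  rw [← comm3] at hv
  have := Module.Flat.rTensor_preserves_injective_linearMap (M := Fin b → R) i hi hv
  rw [← this]
  exact (lTensor_exact Y hfg hg).apply_apply_eq_zero v'

lemma PA.of_ses {Y E Y' : Type u} [AddCommGroup Y] [Module R Y] [AddCommGroup E]
    [Module R E] [AddCommGroup Y'] [Module R Y'] {i : Y →ₗ[R] E} {p : E →ₗ[R] Y'}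
    (hi : Function.Injective i) (hip : Function.Exact i p) (hp : Function.Surjective p)
    (hA : PA R Y') (hE : PA R E) : PA R Y := by
  intro M M' _ _ _ _ b f g hf hfg hg hM hM'
  have h1 := hE M M' b f g hf hfg hg hM hM'
  have h2 := PA.tensor_injective hi hip hp hA M hM
  have h3 : Function.Injective (LinearMap.lTensor E f ∘ₗ LinearMap.rTensor M i) := by
    rw [LinearMap.coe_comp]; exact h1.comp h2
  rw [LinearMap.lTensor_comp_rTensor, ← LinearMap.rTensor_comp_lTensor, LinearMap.coe_comp] at h3
  exact h3.of_comp

theorem GP.gorensteinFlat {n : ℕ} (hR : FID R R n) (M : Type u) [AddCommGroup M] [Module R M]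
    (hM : GP R M) : GG.IsGorensteinFlat R M := by
  obtain ⟨c⟩ := hM.cr hR
  refine ⟨fun n => ModuleCat.of R (Fin (c.b n) → R), fun n => c.f (n + 1) ∘ₗ c.g n, ?_, ?_, ?_, ?_⟩
  · intro n
    change Module.Flat R (Fin (c.b n) → R)
    infer_instance
  · intro n
    exact range_eq_ker_of_splice _ _ _ _ (c.hg n) (c.hfg (n + 1)) (c.hf _)
  · intro I hI n
    rw [LinearMap.lTensor_comp, LinearMap.lTensor_comp]
    exact range_eq_ker_of_splice _ _ _ _ (LinearMap.lTensor_surjective _ (c.hg n))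
      (lTensor_exact _ (c.hfg (n + 1)) (c.hg _))
      (PA.of_injective hI _ _ _ _ _ (c.hf _) (c.hfg _) (c.hg _) (c.gp _) (c.gp _))
  · obtain ⟨e⟩ := equiv_ker_of_splice (R := R) _ _ _ (c.hf 0) (c.hfg 0) (c.hf (0 + 1))
    exact ⟨c.e0.trans e⟩

lemma injective_tensor_free {E : Type u} [AddCommGroup E] [Module R E] (hE : Module.Injective R E)
    (b : ℕ) : Module.Injective R (E ⊗[R] (Fin b → R)) :=
  inj_of_equiv (TensorProduct.piScalarRight R R E (Fin b)).symm inferInstance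

/-- `Hom(I,E) ⊗ P → Hom(I, E ⊗ P)`. -/
lemma nu_bij {I E : Type u} [AddCommGroup E] [Module R E] [AddCommGroup I] [Module R I] (b : ℕ) :
    Function.Bijective (TensorProduct.rTensorHomToHomRTensor (RingHom.id R) I E (Fin b → R)) := by
  constructor
  · rw [injective_iff_map_eq_zero]
    intro t ht
    obtain ⟨h, rfl⟩ := exists_sum_single t
    have : ∀ i, h i = 0 := by
      intro i
      ext x
      have h1 := LinearMap.congr_fun ht x
      rw [map_sum, LinearMap.sum_apply] at h1
      simp only [TensorProduct.rTensorHomToHomRTensor_apply] at h1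
      have h2 := congrArg (coordT E i) h1
      rw [coordT_sum (fun i => h i x) i] at h2
      simpa using h2
    simp [this]
  · intro φ
    refine ⟨∑ i, (coordT E i ∘ₗ φ) ⊗ₜ Pi.single i 1, ?_⟩
    ext x
    rw [map_sum, LinearMap.sum_apply]
    simp only [TensorProduct.rTensorHomToHomRTensor_apply]
    obtain ⟨h, hh⟩ := exists_sum_single (φ x)
    rw [hh]
    refine Finset.sum_congr rfl fun i _ => ?_
    rw [LinearMap.comp_apply, hh, coordT_sum]

theorem GP.gorensteinInjective {n : ℕ} (hR : FID R R n) (M : Type u) [AddCommGroup M] [Module R M]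
    (hM : GP R M) (E : Type u) [AddCommGroup E] [Module R E] (hE : Module.Injective R E) :
    GG.IsGorensteinInjective R (E ⊗[R] M) := by
  obtain ⟨c⟩ := hM.cr hR
  have hinj : ∀ n, Function.Injective (LinearMap.lTensor E (c.f n)) := fun n =>
    PA.of_injective hE _ _ _ _ _ (c.hf _) (c.hfg _) (c.hg _) (c.gp _) (c.gp _)
  refine ⟨fun n => ModuleCat.of R (E ⊗[R] (Fin (c.b n) → R)),
    fun n => LinearMap.lTensor E (c.f (n + 1)) ∘ₗ LinearMap.lTensor E (c.g n), ?_, ?_, ?_, ?_⟩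
  · intro n
    exact injective_tensor_free hE _
  · intro n
    exact range_eq_ker_of_splice _ _ _ _ (LinearMap.lTensor_surjective _ (c.hg n))
      (lTensor_exact _ (c.hfg (n + 1)) (c.hg _)) (hinj _)
  · intro I hI n φ hφ
    have hflat := flat_hom hI hE
    have nat : ∀ n (t : (I →ₗ[R] E) ⊗[R] (Fin (c.b n) → R)),
        TensorProduct.rTensorHomToHomRTensor (RingHom.id R) I E _
          (LinearMap.lTensor _ (c.f (n + 1) ∘ₗ c.g n) t) =
        (LinearMap.lTensor E (c.f (n + 1)) ∘ₗ LinearMap.lTensor E (c.g n)) ∘ₗ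
          TensorProduct.rTensorHomToHomRTensor (RingHom.id R) I E _ t := by
      intro n t
      induction t using TensorProduct.induction_on with
      | zero => simp
      | tmul h m => ext; simp
      | add x y hx hy => rw [map_add, map_add, hx, hy, map_add, LinearMap.comp_add]
    obtain ⟨t, rfl⟩ := (nu_bij _).2 φ
    have h0 : LinearMap.lTensor (I →ₗ[R] E) (c.f (n + 1 + 1) ∘ₗ c.g (n + 1)) t = 0 := by
      apply (nu_bij _).1
      rw [nat, map_zero]
      exact hφ
    have hex : Function.Exact (c.f (n + 1) ∘ₗ c.g n) (c.f (n + 1 + 1) ∘ₗ c.g (n + 1)) :=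
      LinearMap.exact_iff.2
        (range_eq_ker_of_splice _ _ _ _ (c.hg n) (c.hfg (n + 1)) (c.hf _)).symm
    obtain ⟨t', rfl⟩ := (Module.Flat.lTensor_exact (I →ₗ[R] E) hex _).1 h0
    exact ⟨_, (nat n t').symm⟩
  · obtain ⟨e⟩ := equiv_ker_of_splice (R := R) _ _ _ (hinj 0)
      (lTensor_exact E (c.hfg 0) (c.hg 0)) (hinj (0 + 1))
    exact ⟨(c.e0.lTensor E).trans e⟩

end
end GGP
set_option linter.unusedSectionVars false
namespace GGP
open IsLocalRing RingTheory.Sequence Pointwise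

section
variable {R : Type u} [CommRing R] [IsNoetherianRing R] [IsLocalRing R]

/-- Ext vanishing condition along primes containing `J`. -/
def DP (Y : Type u) [AddCommGroup Y] [Module R Y] (J : Ideal R) (e : ℕ) : Prop :=
  ∀ (p : Ideal R), p.IsPrime → J ≤ p → ∀ ys : List R, (∀ y ∈ ys, y ∈ maximalIdeal R) →
    maximalIdeal R ≤ (p ⊔ Ideal.ofList ys).radical → ∀ j, j + ys.length < e →
      XZ (R := R) (R ⧸ p) Y j

lemma weaklyRegular_of_DP (rs : List R) : ∀ (Y : Type u) [AddCommGroup Y] [Module R Y]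
    (J : Ideal R) (e : ℕ), DP Y J e → (∀ a ∈ J, ∀ y : Y, a • y = 0) →
    (∀ r ∈ rs, r ∈ maximalIdeal R) → maximalIdeal R ≤ (J ⊔ Ideal.ofList rs).radical →
    rs.length ≤ e → IsWeaklyRegular Y rs := by
  induction rs with
  | nil => intro Y _ _ J e _ _ _ _ _; exact IsWeaklyRegular.nil R Y
  | cons x rs ih =>
    intro Y _ _ J e hY hJ hrs hrad hlen
    rw [List.length_cons] at hlen
    have hx : IsSMulRegular Y x := by
      rw [isSMulRegular_iff_right_eq_zero_of_smul]
      intro y hxy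
      by_contra hy
      obtain ⟨p, hp, hle⟩ := exists_le_isAssociatedPrime_of_isNoetherianRing R y hy
      obtain ⟨hpp, f, hf⟩ := (isAssociatedPrime_iff_exists_injective_linearMap _ _).1 hp
      have hsub : J ⊔ Ideal.span {x} ≤ p := by
        refine sup_le (fun a ha => hle ?_) ((Ideal.span_singleton_le_iff_mem _).2 (hle ?_))
        · simpa [Submodule.mem_colon_singleton] using hJ a ha y
        · simpa [Submodule.mem_colon_singleton] using hxy
      have h0 := hY p hpp (le_sup_left.trans hsub) rs (fun y hy => hrs y (by simp [hy]))
        (hrad.trans (Ideal.radical_mono (by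
          rw [Ideal.ofList_cons, ← sup_assoc]; exact sup_le_sup_right hsub _))) 0 (by omega)
      have := XZ_zero_iff.1 h0 f
      have h1 : (1 : R ⧸ p) = 0 := hf (by rw [this]; rfl)
      exact hpp.ne_top (Ideal.Quotient.zero_eq_one_iff.1 h1.symm)
    rw [isWeaklyRegular_cons_iff]
    refine ⟨hx, ih (QuotSMulTop x Y) (J ⊔ Ideal.span {x}) (e - 1) ?_ ?_
      (fun y hy => hrs y (by simp [hy])) ?_ (by omega)⟩
    · intro p hp hle ys hys hr j hj
      have hJp := le_sup_left.trans hle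
      refine XS.cov_right (f := LinearMap.lsmul R Y x) (g := Submodule.mkQ (x • (⊤ : Submodule R Y)))
        _ hx ?_ (Submodule.mkQ_surjective _)
        (hY p hp hJp ys hys hr j (by omega)) (hY p hp hJp ys hys hr (j + 1) (by omega))
      intro y
      rw [Submodule.mkQ_apply, Submodule.Quotient.mk_eq_zero]
      constructor
      · rintro ⟨z, -, rfl⟩; exact ⟨z, rfl⟩
      · rintro ⟨z, rfl⟩; exact ⟨z, trivial, rfl⟩
    · intro a ha y
      obtain ⟨y, rfl⟩ := Submodule.mkQ_surjective _ y
      obtain ⟨b, hb, c, hc, rfl⟩ := Submodule.mem_sup.1 ha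
      obtain ⟨c, rfl⟩ := Ideal.mem_span_singleton'.1 hc
      rw [add_smul, ← map_smul, hJ b hb, map_zero, zero_add, ← map_smul, Submodule.mkQ_apply,
        Submodule.Quotient.mk_eq_zero]
      exact ⟨c • y, trivial, by simp [mul_smul]⟩
    · rw [Ideal.ofList_cons, ← sup_assoc] at hrad
      exact hrad

lemma XZ_pow {N Y : Type u} [AddCommGroup N] [Module R N] [AddCommGroup Y] [Module R Y] {j : ℕ}
    (h : XZ (R := R) N Y j) (b : ℕ) : XZ (R := R) N (Fin b → Y) j := by
  induction b with
  | zero => exact XZ.of_subsingleton_right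
  | succ b ih =>
    refine XZ.congr (LinearEquiv.refl R N) (Fin.consLinearEquiv R (fun _ : Fin (b+1) => Y)) ?_
    exact XS.cov_mid (f := LinearMap.inl R Y (Fin b → Y)) (g := LinearMap.snd R Y (Fin b → Y)) _
      LinearMap.inl_injective Function.Exact.inl_snd LinearMap.snd_surjective h ih

lemma GP.DP {n : ℕ} (hR : FID R R n) {d : ℕ} (hd : (maximalIdeal R).height = d) 
    (M : Type u) [AddCommGroup M] [Module R M] (hM : GP R M) : DP M (⊥ : Ideal R) d := by
  intro p hp _ ys hys hr j
  induction j generalizing M with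
  | zero =>
    intro hj
    obtain ⟨M', hM', b, f, g, hf, hfg, hg⟩ := GP.next hR M hM
    exact XS.cov_mono _ hf (XZ_pow (H5 hR hd ys hys p hp hr 0 hj) b)
  | succ j ih =>
    intro hj
    obtain ⟨M', hM', b, f, g, hf, hfg, hg⟩ := GP.next hR M hM
    exact XS.cov_left _ hf hfg hg (ih M' hM' (by omega)) 
      (XZ_pow (H5 hR hd ys hys p hp hr (j + 1) hj) b)

theorem GP.balanced {n : ℕ} (hR : FID R R n) (M : Type u) [AddCommGroup M] [Module R M] 
    [Nontrivial M] (hM : GP R M) : GG.IsBalancedBigCM R M := by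
  intro rs hrs
  obtain ⟨h1, h2, h3⟩ := hrs
  rw [← maximalIdeal_height_eq_ringKrullDim] at h1
  have hd : (maximalIdeal R).height = (rs.length : ℕ∞) := by exact_mod_cast h1.symm
  have := hM.1
  refine ⟨weaklyRegular_of_DP rs M ⊥ rs.length (hM.DP hR hd M) ?_ h2 ?_ le_rfl, ?_⟩
  · intro a ha y
    rw [(Submodule.mem_bot R).1 ha, zero_smul]
  · rw [bot_sup_eq]; exact h3
  · refine (smul_top_lt (Ideal.span_le.2 ?_) M).ne'
    exact h2

lemma GP.self : GP R R :=
  ⟨inferInstance, fun _ hi => XZ.of_projective hi⟩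
end
end GGP
set_option linter.unusedSectionVars false
namespace GGP
open IsLocalRing TensorProduct CategoryTheory CategoryTheory.Abelian

section
variable {R : Type u} [CommRing R] 

lemma XZ.retract {A B Y : Type u} [AddCommGroup A] [Module R A] [AddCommGroup B] [Module R B]
    [AddCommGroup Y] [Module R Y] (s : A →ₗ[R] B) (r : B →ₗ[R] A) (h : r ∘ₗ s = LinearMap.id)
    {i : ℕ} (hB : XZ (R := R) B Y i) : XZ (R := R) A Y i := by
  rw [XZ_iff] at *
  intro e
  have h1 := hB ((Ext.mk₀ (ModuleCat.ofHom r)).comp e (zero_add i))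
  have h2 := congrArg (fun z => (Ext.mk₀ (ModuleCat.ofHom s)).comp z (zero_add i)) h1
  simp only [Ext.comp_zero] at h2
  rw [Ext.mk₀_comp_mk₀_assoc, ← ModuleCat.ofHom_comp, h] at h2
  rw [← h2]
  exact (Ext.mk₀_id_comp e).symm

lemma XZ.retract_right {A B Y : Type u} [AddCommGroup A] [Module R A] [AddCommGroup B] [Module R B]
    [AddCommGroup Y] [Module R Y] (s : A →ₗ[R] B) (r : B →ₗ[R] A) (h : r ∘ₗ s = LinearMap.id)
    {i : ℕ} (hB : XZ (R := R) Y B i) : XZ (R := R) Y A i := by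
  rw [XZ_iff] at *
  intro e
  have h1 := hB (e.comp (Ext.mk₀ (ModuleCat.ofHom s)) (add_zero i))
  have h2 := congrArg (fun z => z.comp (Ext.mk₀ (ModuleCat.ofHom r)) (add_zero i)) h1
  simp only [Ext.zero_comp] at h2
  rw [Ext.comp_assoc_of_third_deg_zero, Ext.mk₀_comp_mk₀, ← ModuleCat.ofHom_comp, h] at h2
  rw [← h2]
  exact (Ext.comp_mk₀_id e).symm

variable [IsNoetherianRing R]

lemma projective_of_XZ {M : Type u} [AddCommGroup M] [Module R M] [Module.Finite R M]
    (h : ∀ (Y : Type u) [AddCommGroup Y] [Module R Y] [Module.Finite R Y], XZ (R := R) M Y 1) :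
    Module.Projective R M := by
  obtain ⟨K, hK, b, f, g, hf, hfg, hg⟩ := Step.exists_prev (R := R) M
  obtain ⟨s, hs⟩ := (h K).lift hf hfg hg LinearMap.id
  exact Module.Projective.of_split s g hs

lemma FPD.of_projective {M : Type u} [AddCommGroup M] [Module R M] (h : Module.Projective R M)
    (n : ℕ) : FPD R M n := fun _ _ _ _ hi => XZ.of_projective (by omega)

lemma FPD.of_step {M M' : Type u} [AddCommGroup M] [Module R M] [AddCommGroup M'] [Module R M']
    (hs : Step R M M') {n : ℕ} (h : FPD R M n) : FPD R M' (n + 1) := by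
  intro Y _ _ i hi
  obtain ⟨i, rfl⟩ : ∃ j, i = j + 1 := ⟨i - 1, by omega⟩
  exact (hs.xz_iff (by omega)).2 (h Y i (by omega))

lemma FPD.step {M M' : Type u} [AddCommGroup M] [Module R M] [AddCommGroup M'] [Module R M']
    (hs : Step R M M') {n : ℕ} (h : FPD R M' (n + 1)) : FPD R M n := by
  intro Y _ _ i hi
  exact (hs.xz_iff (by omega)).1 (h Y (i + 1) (by omega))

variable [IsLocalRing R]

/-- depth zero: finite projective dimension implies projective. -/
lemma free_of_depth_zero {z : R} (hz : z ≠ 0) (hzm : ∀ a ∈ maximalIdeal R, z * a = 0) (n : ℕ) :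
    ∀ (M : Type u) [AddCommGroup M] [Module R M] [Module.Finite R M], FPD R M n →
      Module.Free R M := by
  induction n with
  | zero =>
    intro M _ _ _ h
    have := projective_of_XZ (R := R) (M := M) fun Y _ _ _ => h Y 1 (by omega)
    exact Module.free_of_flat_of_isLocalRing
  | succ n ih =>
    intro M _ _ _ h
    obtain ⟨K, hK, hs⟩ := Step.exists_prev (R := R) M
    have hKf : Module.Free R K := ih K (FPD.step hs h)
    obtain ⟨b, f, g, hf, hfg, hg⟩ := hs
    refine Module.free_of_lTensor_residueField_injective f g hg hfg ?_
    rw [injective_iff_map_eq_zero]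
    intro t ht
    obtain ⟨v, rfl⟩ : ∃ v : K, (1 : ResidueField R) ⊗ₜ[R] v = t :=
      TensorProduct.mk_surjective R K (ResidueField R) Ideal.Quotient.mk_surjective t
    rw [LinearMap.lTensor_tmul] at ht
    have hv : f v ∈ maximalIdeal R • (⊤ : Submodule R (Fin b → R)) := by
      rw [← LinearMap.ker_tensorProductMk]; exact ht
    have hzv : z • v = 0 := by
      apply hf
      rw [map_smul, map_zero]
      refine Submodule.smul_induction_on hv ?_ ?_
      · intro a ha w _
        rw [← mul_smul, hzm a ha, zero_smul]
      · intro x y hx hy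
        rw [smul_add, hx, hy, add_zero]
    have hvm : v ∈ maximalIdeal R • (⊤ : Submodule R K) := by
      let bs := Module.Free.chooseBasis R K
      rw [← bs.sum_repr v]
      refine Submodule.sum_mem _ fun i _ => Submodule.smul_mem_smul ?_ trivial
      rw [mem_maximalIdeal, mem_nonunits_iff]
      intro hu
      have h1 : z * bs.repr v i = 0 := by
        have := congrArg (fun w => bs.repr w i) hzv
        simpa using this
      exact hz ((hu.mul_left_eq_zero).1 h1)
    rw [← LinearMap.ker_tensorProductMk] at hvm
    exact hvm

end

/-- base change along a regular element. -/
lemma FPD.baseChange {R : Type u} [CommRing R] [IsNoetherianRing R] {x : R}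
    (hxR : IsSMulRegular R x) (n : ℕ) :
    ∀ (M : Type u) [AddCommGroup M] [Module R M] [Module.Finite R M], IsSMulRegular M x →
      FPD R M n → FPD (R ⧸ Ideal.span {x}) ((R ⧸ Ideal.span {x}) ⊗[R] M) n := by
  induction n with
  | zero =>
    intro M _ _ _ _ h
    have := projective_of_XZ (R := R) (M := M) fun Y _ _ _ => h Y 1 (by omega)
    exact FPD.of_projective inferInstance 0
  | succ n ih =>
    intro M _ _ _ hxM h
    obtain ⟨K, hK, hs⟩ := Step.exists_prev (R := R) M
    have hK' := FPD.step hs h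
    obtain ⟨b, f, g, hf, hfg, hg⟩ := hs
    have hxK : IsSMulRegular K x := by
      rw [isSMulRegular_iff_right_eq_zero_of_smul]
      intro v hv
      apply hf
      have : x • f v = 0 := by rw [← map_smul, hv, map_zero]
      rw [map_zero]
      ext i
      exact (isSMulRegular_iff_right_eq_zero_of_smul.1 hxR) _ (congrFun this i)
    have ih' := ih K hxK hK'
    have hproj : Module.Projective (R ⧸ Ideal.span {x}) ((R ⧸ Ideal.span {x}) ⊗[R] (Fin b → R)) :=
      inferInstance
    have h1 : Function.Injective (f.baseChange (R ⧸ Ideal.span {x})) := by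
      rw [injective_iff_map_eq_zero]
      intro t ht
      obtain ⟨v, rfl⟩ : ∃ v : K, (1 : R ⧸ Ideal.span {x}) ⊗ₜ[R] v = t :=
        TensorProduct.mk_surjective R K (R ⧸ Ideal.span {x}) Ideal.Quotient.mk_surjective t
      rw [LinearMap.baseChange_tmul] at ht
      have hv : f v ∈ Ideal.span {x} • (⊤ : Submodule R (Fin b → R)) := by
        rw [← LinearMap.ker_tensorProductMk]; exact ht
      rw [Submodule.ideal_span_singleton_smul] at hv
      obtain ⟨w, -, hw⟩ := hv
      replace hw : x • w = f v := hw
      have hgw : g w = 0 := by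
        apply (isSMulRegular_iff_right_eq_zero_of_smul.1 hxM)
        rw [← map_smul, hw, hfg.apply_apply_eq_zero]
      obtain ⟨u, rfl⟩ := (hfg w).1 hgw
      rw [← map_smul] at hw
      rw [← hf hw]
      have hvm : x • u ∈ Ideal.span {x} • (⊤ : Submodule R K) :=
        Submodule.smul_mem_smul (Ideal.mem_span_singleton_self x) trivial
      rw [← LinearMap.ker_tensorProductMk] at hvm
      exact hvm
    intro Y _ _ i hi
    obtain ⟨i, rfl⟩ : ∃ j, i = j + 1 := ⟨i - 1, by omega⟩
    refine XS.contra_right (f := f.baseChange (R ⧸ Ideal.span {x}))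
      (g := g.baseChange (R ⧸ Ideal.span {x})) _ h1 ?_ ?_ (ih' Y i (by omega))
      (XZ.of_projective (by omega))
    · exact lTensor_exact (R ⧸ Ideal.span {x}) hfg hg
    · exact LinearMap.lTensor_surjective _ hg
end GGP
set_option linter.unusedSectionVars false
namespace GGP
open IsLocalRing TensorProduct

lemma exists_cotangent_functional {R : Type u} [CommRing R] [IsLocalRing R]
    {x : R} (hx : x ∈ maximalIdeal R) (hx2 : x ∉ maximalIdeal R ^ 2) :
    ∃ φ : maximalIdeal R →ₗ[R] ResidueField R, φ ⟨x, hx⟩ = 1 := by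
  have h0 : (maximalIdeal R).toCotangent ⟨x, hx⟩ ≠ 0 := by
    rw [Ne, Ideal.toCotangent_eq_zero]; exact hx2
  have : ∃ ψ : Module.Dual (ResidueField R) (CotangentSpace R),
      ψ ((maximalIdeal R).toCotangent ⟨x, hx⟩) ≠ 0 := by
    by_contra hcon
    push Not at hcon
    exact h0 ((Module.forall_dual_apply_eq_zero_iff (ResidueField R)
      ((maximalIdeal R).toCotangent ⟨x, hx⟩ : CotangentSpace R)).1 hcon)
  obtain ⟨ψ, hψ⟩ := this
  let ψ' : CotangentSpace R →ₗ[ResidueField R] ResidueField R :=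
    (ψ ((maximalIdeal R).toCotangent ⟨x, hx⟩))⁻¹ • ψ
  refine ⟨(ψ'.restrictScalars R) ∘ₗ (maximalIdeal R).toCotangent, ?_⟩
  change (ψ ((maximalIdeal R).toCotangent ⟨x, hx⟩))⁻¹ * ψ ((maximalIdeal R).toCotangent ⟨x, hx⟩) = 1
  exact inv_mul_cancel₀ hψ

/-- `k` is a retract of `m/xm`. -/
lemma exists_retract {R : Type u} [CommRing R] [IsLocalRing R]
    {x : R} (hx : x ∈ maximalIdeal R) (hx2 : x ∉ maximalIdeal R ^ 2)
    (S : Type u) [CommRing S] [IsLocalRing S] [Algebra R S]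
    (hsurj : Function.Surjective (algebraMap R S)) (hx0 : algebraMap R S x = 0)
    (hmem : ∀ y : R, algebraMap R S y ∈ maximalIdeal S ↔ y ∈ maximalIdeal R) :
    ∃ (s : (S ⧸ maximalIdeal S) →ₗ[S] S ⊗[R] maximalIdeal R)
      (r : S ⊗[R] maximalIdeal R →ₗ[S] (S ⧸ maximalIdeal S)), r ∘ₗ s = LinearMap.id := by
  obtain ⟨φ, hφ⟩ := exists_cotangent_functional hx hx2
  let k := S ⧸ maximalIdeal S
  let ρ : (R ⧸ maximalIdeal R) →ₗ[R] k := Submodule.liftQ (maximalIdeal R) (Algebra.linearMap R k)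
    (by
      intro y hy
      rw [LinearMap.mem_ker]
      exact Ideal.Quotient.eq_zero_iff_mem.2 ((hmem y).2 hy))
  let ψ : maximalIdeal R →ₗ[R] k := ρ ∘ₗ φ
  have hψ : ψ ⟨x, hx⟩ = 1 := by
    change ρ (φ ⟨x, hx⟩) = 1
    rw [hφ]
    exact (Submodule.liftQ_apply _ _ (1 : R)).trans (map_one (algebraMap R k))
  let s0 : S →ₗ[S] S ⊗[R] maximalIdeal R := LinearMap.toSpanSingleton _ _ (1 ⊗ₜ ⟨x, hx⟩)
  have hs0 : maximalIdeal S ≤ LinearMap.ker s0 := by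
    intro y hy
    obtain ⟨y, rfl⟩ := hsurj y
    rw [hmem] at hy
    rw [LinearMap.mem_ker, LinearMap.toSpanSingleton_apply, algebraMap_smul,
      ← TensorProduct.tmul_smul]
    have : y • (⟨x, hx⟩ : maximalIdeal R) = x • (⟨y, hy⟩ : maximalIdeal R) :=
      Subtype.ext (mul_comm y x)
    rw [this, ← TensorProduct.smul_tmul, Algebra.smul_def, hx0, zero_mul, TensorProduct.zero_tmul]
  refine ⟨Submodule.liftQ _ s0 hs0, LinearMap.liftBaseChange S ψ, ?_⟩
  refine Submodule.linearMap_qext _ ?_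
  refine LinearMap.ext_ring ?_
  change LinearMap.liftBaseChange S ψ (s0 1) = _
  rw [LinearMap.toSpanSingleton_apply, one_smul, LinearMap.liftBaseChange_tmul, hψ, one_smul]
  rfl

lemma exists_good_element {R : Type u} [CommRing R] [IsLocalRing R] [IsNoetherianRing R]
    (h : ¬ ∃ z : R, z ≠ 0 ∧ ∀ a ∈ maximalIdeal R, z * a = 0) :
    ∃ x ∈ maximalIdeal R, x ∉ maximalIdeal R ^ 2 ∧ IsSMulRegular R x := by
  by_contra hcon
  push Not at hcon
  have hfin := associatedPrimes.finite R R
  have hsub : ((maximalIdeal R : Ideal R) : Set R) ⊆ ((maximalIdeal R ^ 2 : Ideal R) : Set R) ∪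
      ((maximalIdeal R ^ 2 : Ideal R) : Set R) ∪ ⋃ p ∈ (hfin.toFinset : Set (Ideal R)), (p : Set R) := by
    intro x hx
    by_cases hx2 : x ∈ maximalIdeal R ^ 2
    · exact Or.inl (Or.inl hx2)
    · right
      have := hcon x hx hx2
      rw [isSMulRegular_iff_right_eq_zero_of_smul] at this
      push Not at this
      obtain ⟨y, hxy, hy⟩ := this
      obtain ⟨p, hp, hle⟩ := exists_le_isAssociatedPrime_of_isNoetherianRing R y hy
      simp only [Set.mem_iUnion]
      exact ⟨p, hfin.mem_toFinset.2 hp, hle (by simpa [Submodule.mem_colon_singleton] using hxy)⟩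
  have hno : ∀ p ∈ associatedPrimes R R, ¬ maximalIdeal R ≤ p := by
    intro p hp hle
    obtain ⟨hpp, f, hf⟩ := (isAssociatedPrime_iff_exists_injective_linearMap _ _).1 hp
    refine h ⟨f 1, fun h0 => ?_, fun a ha => ?_⟩
    · have h1 : (1 : R ⧸ p) = 0 := hf (by rw [h0, map_zero])
      exact hpp.ne_top (Ideal.Quotient.zero_eq_one_iff.1 h1.symm)
    · rw [mul_comm, ← smul_eq_mul, ← map_smul, Algebra.smul_def, mul_one]
      have : algebraMap R (R ⧸ p) a = 0 := Ideal.Quotient.eq_zero_iff_mem.2 (hle ha)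
      rw [this, map_zero]
  have hm2 : ¬ maximalIdeal R ≤ maximalIdeal R ^ 2 := by
    intro hle
    have hbot : maximalIdeal R = ⊥ := by
      refine Submodule.eq_bot_of_le_smul_of_le_jacobson_bot (maximalIdeal R) _
        (IsNoetherian.noetherian _) ?_ ?_
      · rw [smul_eq_mul, ← sq]; exact hle
      · rw [IsLocalRing.jacobson_eq_maximalIdeal _ bot_ne_top]
    refine h ⟨1, one_ne_zero, fun a ha => ?_⟩
    rw [hbot] at ha
    rw [(Submodule.mem_bot R).1 ha, mul_zero]
  have := (Ideal.subset_union_prime' (f := fun p : Ideal R => p) (s := hfin.toFinset)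
    (a := maximalIdeal R ^ 2) (b := maximalIdeal R ^ 2)
    (fun p hp => ((hfin.mem_toFinset.1 hp).1)) (I := maximalIdeal R)).1 hsub
  rcases this with h1 | h1 | ⟨p, hp, h1⟩
  · exact hm2 h1
  · exact hm2 h1
  · exact hno p (hfin.mem_toFinset.1 hp) h1

theorem serre (d : ℕ) : ∀ (R : Type u) [CommRing R] [IsLocalRing R] [IsNoetherianRing R],
    ringKrullDim R = d → ∀ n, FPD R (R ⧸ maximalIdeal R) n → IsRegularLocalRing R := by
  have key : ∀ (R : Type u) [CommRing R] [IsLocalRing R] [IsNoetherianRing R] (n : ℕ),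
      FPD R (R ⧸ maximalIdeal R) n → IsRegularLocalRing R ∨
      ∃ x ∈ maximalIdeal R, ∃ (_ : IsLocalRing (R ⧸ Ideal.span {x})),
        ringKrullDim (R ⧸ Ideal.span {x}) + 1 = ringKrullDim R ∧
        ∃ n, FPD (R ⧸ Ideal.span {x}) ((R ⧸ Ideal.span {x}) ⧸ maximalIdeal (R ⧸ Ideal.span {x})) n := by
    intro R _ _ _ n hn
    by_cases h : ∃ z : R, z ≠ 0 ∧ ∀ a ∈ maximalIdeal R, z * a = 0
    · left
      obtain ⟨z, hz, hzm⟩ := h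
      have hfree := free_of_depth_zero hz hzm n (R ⧸ maximalIdeal R) hn
      have hbot : maximalIdeal R = ⊥ := by
        rw [eq_bot_iff]
        intro a ha
        rw [Submodule.mem_bot]
        have hinj : Function.Injective (algebraMap R (R ⧸ maximalIdeal R)) :=
          FaithfulSMul.algebraMap_injective R (R ⧸ maximalIdeal R)
        apply hinj
        rw [map_zero]
        exact Ideal.Quotient.eq_zero_iff_mem.2 ha
      apply IsRegularLocalRing.of_spanFinrank_maximalIdeal_le
      rw [hbot, Submodule.spanFinrank_bot]
      exact ringKrullDim_nonneg_of_nontrivial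
    · right
      obtain ⟨x, hx, hx2, hreg⟩ := exists_good_element h
      have hne : Nontrivial (R ⧸ Ideal.span {x}) := Ideal.Quotient.nontrivial_iff.2 fun ht =>
        (maximalIdeal.isMaximal R).ne_top (top_le_iff.1 (ht ▸ (Ideal.span_singleton_le_iff_mem _).2 hx))
      have hl : IsLocalRing (R ⧸ Ideal.span {x}) :=
        IsLocalRing.of_surjective' (Ideal.Quotient.mk (Ideal.span {x})) Ideal.Quotient.mk_surjective
      refine ⟨x, hx, hl, ?_, n, ?_⟩
      · exact ringKrullDim_quotient_span_singleton_succ_eq_ringKrullDim_of_mem_jacobson hreg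
          (by rw [IsLocalRing.ringJacobson_eq_maximalIdeal]; exact hx)
      · have hloc : IsLocalHom (Ideal.Quotient.mk (Ideal.span {x})) :=
          IsLocalHom.of_surjective _ Ideal.Quotient.mk_surjective
        obtain ⟨s, r, hsr⟩ := exists_retract hx hx2 (R ⧸ Ideal.span {x})
          Ideal.Quotient.mk_surjective (Ideal.Quotient.eq_zero_iff_mem.2
            (Ideal.mem_span_singleton_self x)) (fun y => by
              rw [mem_maximalIdeal, mem_maximalIdeal, mem_nonunits_iff, mem_nonunits_iff]
              exact not_congr (isUnit_map_iff (Ideal.Quotient.mk (Ideal.span {x})) y))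
        have hm : FPD R (maximalIdeal R) n := by
          intro Y _ _ i hi
          exact XS.contra_left (f := (maximalIdeal R).subtype) (g := (maximalIdeal R).mkQ) _
            (Submodule.injective_subtype _) (LinearMap.exact_subtype_mkQ _)
            (Submodule.mkQ_surjective _) (XZ.of_projective (by omega)) (hn Y (i + 1) (by omega))
        have hxm : IsSMulRegular (maximalIdeal R) x := by
          rw [isSMulRegular_iff_right_eq_zero_of_smul] at hreg ⊢
          intro v hv
          exact Subtype.ext (hreg v (congrArg Subtype.val hv))
        have := FPD.baseChange hreg n (maximalIdeal R) hxm hm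
        intro Y _ _ i hi
        exact XZ.retract s r hsr (this Y i hi)
  induction d with
  | zero =>
    intro R _ _ _ hd n hn
    rcases key R n hn with h | ⟨x, hx, hl, hdim, n', hn'⟩
    · exact h
    · exfalso
      have h0 : 0 ≤ ringKrullDim (R ⧸ Ideal.span {x}) := ringKrullDim_nonneg_of_nontrivial
      have h1 : (1 : WithBot ℕ∞) ≤ 0 := by
        calc (1 : WithBot ℕ∞) = 0 + 1 := (zero_add 1).symm
          _ ≤ ringKrullDim (R ⧸ Ideal.span {x}) + 1 := by gcongr
          _ = 0 := by rw [hdim, hd]; rfl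
      exact absurd h1 (by decide)
  | succ d ih =>
    intro R _ _ _ hd n hn
    rcases key R n hn with h | ⟨x, hx, hl, hdim, n', hn'⟩
    · exact h
    · have hd' : ringKrullDim (R ⧸ Ideal.span {x}) = d := by
        rw [hd] at hdim
        have h0 : 0 ≤ ringKrullDim (R ⧸ Ideal.span {x}) := ringKrullDim_nonneg_of_nontrivial
        generalize ringKrullDim (R ⧸ Ideal.span {x}) = a at *
        induction a using WithBot.recBotCoe with
        | bot => simp at h0
        | coe a =>
          have h1 : a + 1 = ((d + 1 : ℕ) : ℕ∞) := by exact_mod_cast hdim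
          induction a using ENat.recTopCoe with
          | top => rw [top_add] at h1; exact absurd h1.symm (ENat.natCast_ne_top _)
          | coe a =>
            have h2 : a + 1 = d + 1 := by exact_mod_cast h1
            have h3 : a = d := by omega
            rw [h3]; rfl
      have hreg := ih (R ⧸ Ideal.span {x}) hd' n' hn'
      apply IsRegularLocalRing.of_spanFinrank_maximalIdeal_le
      obtain ⟨s, hs1, hs2⟩ := (IsNoetherian.noetherian
        (maximalIdeal (R ⧸ Ideal.span {x}))).exists_span_finset_card_eq_spanFinrank
      rw [← hdim, ← hreg.spanFinrank_maximalIdeal, ← hs1]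
      classical
      let q := Ideal.Quotient.mk (Ideal.span {x})
      have hq : Function.Surjective q := Ideal.Quotient.mk_surjective
      have hloc : IsLocalHom q := IsLocalHom.of_surjective _ Ideal.Quotient.mk_surjective
      have hmem : ∀ y, q y ∈ maximalIdeal (R ⧸ Ideal.span {x}) ↔ y ∈ maximalIdeal R := fun y => by
        rw [mem_maximalIdeal, mem_maximalIdeal, mem_nonunits_iff, mem_nonunits_iff]
        exact not_congr (isUnit_map_iff q y)
      let t : Finset R := insert x (s.image (Function.surjInv hq))
      have hspan : maximalIdeal R = Ideal.span (t : Set R) := by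
        apply le_antisymm
        · intro y hy
          have h1 : q y ∈ Ideal.map q (Ideal.span (t : Set R)) := by
            have h2 : maximalIdeal (R ⧸ Ideal.span {x}) ≤ Ideal.map q (Ideal.span (t : Set R)) := by
              rw [← hs2, Submodule.span_le]
              intro z hz
              rw [← Function.surjInv_eq hq z]
              exact Ideal.mem_map_of_mem q (Ideal.subset_span (by
                simp only [t, Finset.coe_insert, Finset.coe_image]
                exact Or.inr ⟨z, hz, rfl⟩))
            exact h2 ((hmem y).2 hy)
          have h2 : y ∈ Ideal.comap q (Ideal.map q (Ideal.span (t : Set R))) := h1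
          rw [Ideal.comap_map_of_surjective q hq] at h2
          refine (sup_le le_rfl ?_ : _ ≤ Ideal.span (t : Set R)) h2
          intro w hw
          have hw' : w ∈ Ideal.span {x} := Ideal.Quotient.eq_zero_iff_mem.1 hw
          refine Ideal.span_mono ?_ hw'
          simp [t]
        · rw [Ideal.span_le]
          intro w hw
          simp only [t, Finset.coe_insert, Finset.coe_image] at hw
          rcases hw with rfl | ⟨z, hz, rfl⟩
          · exact hx
          · rw [SetLike.mem_coe, ← hmem, Function.surjInv_eq hq z, ← hs2]
            exact Submodule.subset_span hz
      have h1 : (maximalIdeal R).spanFinrank ≤ t.card := by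
        have h2 := Submodule.spanFinrank_span_le_ncard_of_finite (R := R) t.finite_toSet
        rw [Set.ncard_coe_finset] at h2
        rw [hspan]; exact h2
      have h2 : t.card ≤ s.card + 1 := (Finset.card_insert_le _ _).trans
        (Nat.add_le_add_right Finset.card_image_le 1)
      exact_mod_cast h1.trans h2
end GGP
set_option linter.unusedSectionVars false
namespace GGP
open IsLocalRing 

section
variable {R : Type u} [CommRing R] 

lemma char_exact {A B C : Type u} [AddCommGroup A] [Module R A] [AddCommGroup B] [Module R B]
    [AddCommGroup C] [Module R C] {f : A →ₗ[R] B} {g : B →ₗ[R] C} (hfg : Function.Exact f g) :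
    Function.Exact (CharacterModule.dual g) (CharacterModule.dual f) := by
  intro c
  constructor
  · intro hc
    let g' : (B ⧸ LinearMap.range f) →ₗ[R] C := Submodule.liftQ _ g (by
      rw [hfg.linearMap_ker_eq])
    have hg' : Function.Injective g' := by
      rw [← LinearMap.ker_eq_bot]
      exact Submodule.ker_liftQ_eq_bot _ _ _ (by rw [hfg.linearMap_ker_eq])
    let c' : CharacterModule (B ⧸ LinearMap.range f) :=
      QuotientAddGroup.lift (LinearMap.range f).toAddSubgroup c (by
        rintro _ ⟨a, rfl⟩
        exact DFunLike.congr_fun hc a)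
    obtain ⟨e, he⟩ := CharacterModule.dual_surjective_of_injective g' hg' c'
    refine ⟨e, ?_⟩
    ext b
    exact DFunLike.congr_fun he (Submodule.Quotient.mk b)
  · rintro ⟨e, rfl⟩
    ext a
    change e (g (f a)) = 0
    rw [hfg.apply_apply_eq_zero, map_zero]

lemma injective_of_XZ {Y : Type u} [AddCommGroup Y] [Module R Y]
    (h : ∀ J : Ideal R, XZ (R := R) (R ⧸ J) Y 1) : Module.Injective R Y := by
  apply Module.Baer.injective
  intro I g
  obtain ⟨g', hg'⟩ := (h I).extend (f := I.subtype) (g := I.mkQ) (Submodule.injective_subtype _)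
    (LinearMap.exact_subtype_mkQ _) (Submodule.mkQ_surjective _) g
  exact ⟨g', fun x hx => LinearMap.congr_fun hg' ⟨x, hx⟩⟩

lemma char_injective {M : Type u} [AddCommGroup M] [Module R M] (h : Module.Flat R M) :
    Module.Injective R (CharacterModule M) := Module.Flat.iff_characterModule_injective.1 h

lemma idLE_char {M : Type u} [AddCommGroup M] [Module R M] {n : ℕ} (h : GG.fdLE R M n) :
    GG.idLE R (CharacterModule M) n := by
  obtain ⟨G, d, ε, h1, h2, h3, h4, h5⟩ := h
  refine ⟨fun i => ModuleCat.of R (CharacterModule (G i)), fun i => CharacterModule.dual (d i),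
    CharacterModule.dual ε, fun i => char_injective (h1 i),
    CharacterModule.dual_injective_of_surjective _ h2, ?_, ?_, ?_⟩
  · exact (LinearMap.exact_iff.1 (char_exact (LinearMap.exact_iff.2 h3))).symm
  · intro i
    exact (LinearMap.exact_iff.1 (char_exact (LinearMap.exact_iff.2 (h4 i)))).symm
  · intro i hi x
    refine CharacterModule.ext _ fun y => ?_
    rw [h5 i hi y, map_zero]; rfl

variable [IsNoetherianRing R]

lemma FPD.of_char (n : ℕ) : ∀ (M : Type u) [AddCommGroup M] [Module R M] [Module.Finite R M],
    FID R (CharacterModule M) n → FPD R M n := by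
  induction n with
  | zero =>
    intro M _ _ _ h
    have hinj := injective_of_XZ (R := R) (Y := CharacterModule M) fun J => h _ 1 (by omega)
    have hfl : Module.Flat R M := Module.Flat.iff_characterModule_injective.2 hinj
    have : Module.FinitePresentation R M := Module.finitePresentation_of_finite R M
    exact FPD.of_projective (Module.Flat.projective_of_finitePresentation) 0
  | succ n ih =>
    intro M _ _ _ h
    obtain ⟨K, hK, hs⟩ := Step.exists_prev (R := R) M
    refine FPD.of_step hs (ih K ?_)
    obtain ⟨b, f, g, hf, hfg, hg⟩ := hs
    intro N _ _ i hi
    have := char_injective (R := R) (M := Fin b → R) inferInstance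
    exact XS.cov_right _ (CharacterModule.dual_injective_of_surjective _ hg) (char_exact hfg)
      (CharacterModule.dual_surjective_of_injective _ hf)
      (XZ.of_injective (by omega))
      (h N (i + 1) (by omega))

/-- bounded global dimension -/
def GD (R : Type u) [CommRing R] (d : ℕ) : Prop :=
  ∀ (J : Ideal R), FPD R (R ⧸ J) d

lemma GD.gorensteinInjective {d : ℕ} (hd : GD R d) (M : Type u) [AddCommGroup M] [Module R M]
    (h : GG.IsGorensteinInjective R M) : Module.Injective R M := by
  obtain ⟨X, D, h1, h2, -, ⟨e⟩⟩ := h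
  refine inj_of_equiv e.symm (injective_of_XZ fun J => ?_)
  have key : ∀ (k : ℕ) (n : ℤ) (i : ℕ), 1 ≤ i → d < i + k →
      XZ (R := R) (R ⧸ J) (LinearMap.ker (D n)) i := by
    intro k
    induction k with
    | zero => intro n i _ hi; exact hd J _ i hi
    | succ k ih =>
      intro n i h1i hi
      obtain ⟨m, rfl⟩ : ∃ m, n = m + 1 := ⟨n - 1, by omega⟩
      have := h1 m
      refine XS.cov_right (f := (LinearMap.ker (D m)).subtype)
        (g := (D m).codRestrict (LinearMap.ker (D (m + 1))) fun x => by
          rw [← h2]; exact ⟨x, rfl⟩) _ (Submodule.injective_subtype _) ?_ ?_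
        (XZ.of_injective h1i) (ih m (i + 1) (by omega) (by omega))
      · rw [LinearMap.exact_iff, LinearMap.ker_codRestrict, Submodule.range_subtype]
      · rintro ⟨y, hy⟩
        rw [← h2] at hy
        obtain ⟨x, rfl⟩ := hy
        exact ⟨x, rfl⟩
  exact key d 0 1 le_rfl (by omega)

lemma GD.gorensteinFlat {d : ℕ} (hd : GD R d) (M : Type u) [AddCommGroup M] [Module R M]
    (h : GG.IsGorensteinFlat R M) : Module.Flat R M := by
  obtain ⟨X, D, h1, h2, -, ⟨e⟩⟩ := h
  rw [Module.Flat.iff_characterModule_injective]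
  refine inj_of_equiv (CharacterModule.congr e).symm (injective_of_XZ fun J => ?_)
  have key : ∀ (k : ℕ) (n : ℤ) (i : ℕ), 1 ≤ i → d < i + k →
      XZ (R := R) (R ⧸ J) (CharacterModule (LinearMap.ker (D n))) i := by
    intro k
    induction k with
    | zero => intro n i _ hi; exact hd J _ i hi
    | succ k ih =>
      intro m i h1i hi
      have hs : Function.Surjective ((D m).codRestrict (LinearMap.ker (D (m + 1))) fun x => by
          rw [← h2]; exact ⟨x, rfl⟩) := by
        rintro ⟨y, hy⟩
        rw [← h2] at hy
        obtain ⟨x, rfl⟩ := hy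
        exact ⟨x, rfl⟩
      have := char_injective (h1 m)
      refine XS.cov_right _ (CharacterModule.dual_injective_of_surjective _ hs)
        (char_exact (f := (LinearMap.ker (D m)).subtype) ?_)
        (CharacterModule.dual_surjective_of_injective _ (Submodule.injective_subtype _))
        (XZ.of_injective h1i) (ih (m + 1) (i + 1) (by omega) (by omega))
      · rw [LinearMap.exact_iff, LinearMap.ker_codRestrict, Submodule.range_subtype]
  exact key d 0 1 le_rfl (by omega)

def consG (F : ModuleCat.{u} R) (G : ℕ → ModuleCat.{u} R) : ℕ → ModuleCat.{u} R
  | 0 => F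
  | i + 1 => G i

def consD {F : ModuleCat.{u} R} {G : ℕ → ModuleCat.{u} R} (f : G 0 →ₗ[R] F)
    (d : ∀ i : ℕ, G (i + 1) →ₗ[R] G i) : ∀ i : ℕ,
    (consG F G (i + 1)) →ₗ[R] (consG F G i)
  | 0 => f
  | i + 1 => d i

lemma ResolutionLE_cons {P : ModuleCat.{u} R → Prop} {K F M : Type u} [AddCommGroup K] [Module R K]
    [AddCommGroup F] [Module R F] [AddCommGroup M] [Module R M] {f : K →ₗ[R] F} {g : F →ₗ[R] M}
    (hf : Function.Injective f) (hfg : Function.Exact f g) (hg : Function.Surjective g)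
    (hP : P (ModuleCat.of R F)) {n : ℕ} (h : GG.ResolutionLE R P K n) :
    GG.ResolutionLE R P M (n + 1) := by
  obtain ⟨G, d, ε, h1, h2, h3, h4, h5⟩ := h
  refine ⟨consG (ModuleCat.of R F) G, fun i => consD (f ∘ₗ ε) d i, g, ?_, hg, ?_, ?_, ?_⟩
  · rintro (_ | i)
    · exact hP
    · exact h1 i
  · change LinearMap.ker g = LinearMap.range (f ∘ₗ ε)
    rw [LinearMap.range_comp_of_range_eq_top _ (LinearMap.range_eq_top.2 h2), hfg.linearMap_ker_eq]
  · rintro (_ | i)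
    · change LinearMap.ker (f ∘ₗ ε) = LinearMap.range (d 0)
      rw [LinearMap.ker_comp_of_ker_eq_bot _ (LinearMap.ker_eq_bot.2 hf), h3]
    · exact h4 i
  · rintro (_ | i) hi x
    · omega
    · exact h5 i (by omega) x

lemma fdLE_of_XZ (d : ℕ) : ∀ (M : Type u) [AddCommGroup M] [Module R M],
    (∀ (J : Ideal R) (i : ℕ), d < i → XZ (R := R) (R ⧸ J) (CharacterModule M) i) →
    GG.fdLE R M d := by
  induction d with
  | zero =>
    intro M _ _ h
    have hfl : Module.Flat R M := Module.Flat.iff_characterModule_injective.2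
      (injective_of_XZ fun J => h J 1 (by omega))
    let G' : ℕ → ModuleCat.{u} R := consG (ModuleCat.of R M) fun _ => ModuleCat.of R PUnit
    refine ⟨G', fun i => (0 : (G' (i + 1)) →ₗ[R] (G' i)), (LinearMap.id : M →ₗ[R] M), ?_, Function.surjective_id, ?_, ?_, ?_⟩
    · rintro (_ | i)
      · exact hfl
      · change Module.Flat R PUnit.{u+1}
        infer_instance
    · rw [LinearMap.range_zero]; exact LinearMap.ker_id
    · intro i
      rw [LinearMap.range_zero, LinearMap.ker_zero]
      have : Subsingleton (G' (i + 1)) := inferInstanceAs (Subsingleton PUnit.{u+1})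
      exact Subsingleton.elim _ _
    · rintro (_ | i) hi x
      · omega
      · have : Subsingleton (G' (i + 1)) := inferInstanceAs (Subsingleton PUnit.{u+1})
        exact Subsingleton.elim _ _
  | succ d ih =>
    intro M _ _ h
    let g : (M →₀ R) →ₗ[R] M := Finsupp.linearCombination R id
    have hg : Function.Surjective g := Finsupp.linearCombination_id_surjective R M
    have hex := LinearMap.exact_subtype_ker_map g
    have hker : GG.fdLE R (LinearMap.ker g) d := by
      refine ih _ ?_
      intro J i hi
      have := char_injective (R := R) (M := M →₀ R) inferInstance
      exact XS.cov_right _ (CharacterModule.dual_injective_of_surjective _ hg)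
        (char_exact hex)
        (CharacterModule.dual_surjective_of_injective _ (Submodule.injective_subtype _))
        (XZ.of_injective (by omega))
        (h J (i + 1) (by omega))
    have hfl : Module.Flat R (M →₀ R) := inferInstance
    exact ResolutionLE_cons (P := fun N => Module.Flat R N) (Submodule.injective_subtype _)
      hex hg hfl hker

lemma GD.fd {d : ℕ} (hd : GD R d) (M : Type u) [AddCommGroup M] [Module R M] : GG.fdLE R M d :=
  fdLE_of_XZ d M fun J i hi => hd J _ i hi

variable [IsLocalRing R]

lemma GD.of_regular {n : ℕ} (hR : FID R R n) (h : GG.IsRegularLocal R) : ∃ d, GD R d := by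
  obtain ⟨-, s, hs, hcard⟩ := h
  have hlist : Ideal.ofList s.toList = maximalIdeal R := by
    rw [← hs, Ideal.ofList]; congr 1; ext; simp
  have hsop : GG.IsSOP R s.toList := by
    refine ⟨by rw [Finset.length_toList]; exact hcard, ?_, ?_⟩
    · intro r hr
      rw [← hs]
      exact Ideal.subset_span (by simpa using hr)
    · change _ ≤ (Ideal.ofList s.toList).radical
      rw [hlist]; exact Ideal.le_radical
  have hreg := GP.balanced hR R GP.self _ hsop
  have hk : ∀ (Y : Type u) [AddCommGroup Y] [Module R Y] (j : ℕ), s.card < j →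
      XZ (R := R) (R ⧸ maximalIdeal R) Y j := by
    intro Y _ _ j hj
    have := XZ_quot_regular hreg (Y := Y) (j := j) (by rwa [Finset.length_toList])
    rwa [hlist] at this
  refine ⟨s.card, ?_⟩
  have h1 : ∀ (Y : Type u) [AddCommGroup Y] [Module R Y] [Module.Finite R Y] (q : Ideal R),
      q.IsPrime → ∀ i, s.card < i → XZ (R := R) (R ⧸ q) Y i := by
    intro Y _ _ _ q
    induction q using WellFoundedGT.induction with
    | ind q ih =>
      intro hq i hi
      by_cases hqm : q = maximalIdeal R
      · rw [hqm]; exact hk Y i hi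
      · have hlt : q < maximalIdeal R := lt_of_le_of_ne (IsLocalRing.le_maximalIdeal hq.ne_top) hqm
        obtain ⟨x, hxm, hxq⟩ := SetLike.exists_of_lt hlt
        refine XS.xz_of_local (E3 (maximalIdeal R) hxq hxm (XZ.xs _ ?_))
        refine E4 _ _ fun q' hq' hle => ?_
        rw [Ideal.annihilator_quotient] at hle
        refine ih q' (lt_of_le_of_ne (le_sup_left.trans hle) ?_) hq' (i + 1) (by omega)
        rintro rfl
        exact hxq (hle (Ideal.mem_sup_right (Ideal.mem_span_singleton_self x)))
  intro J
  obtain ⟨K, hK, hKe⟩ := exists_syz (R := R) s.card (R ⧸ J)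
  have hproj : Module.Projective R K := projective_of_XZ fun Y _ _ _ =>
    (hKe Y 1 le_rfl).1 (E4 _ _ fun q hq _ => h1 Y q hq _ (by omega))
  intro Y _ _ i hi
  obtain ⟨i, rfl⟩ : ∃ j, i = j + s.card := ⟨i - s.card, by omega⟩
  exact (hKe Y i (by omega)).2 (XZ.of_projective (by omega))

/-- Serre's theorem, in the frozen form. -/
lemma regular_of_FPD {n : ℕ} (h : FPD R (R ⧸ maximalIdeal R) n) : GG.IsRegularLocal R := by
  obtain ⟨d, hd⟩ : ∃ d : ℕ, ringKrullDim R = d := by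
    rw [← maximalIdeal_height_eq_ringKrullDim]
    have := Ideal.height_ne_top_of_isPrime (I := maximalIdeal R)
    obtain ⟨d, hd⟩ := ENat.ne_top_iff_exists.1 this
    exact ⟨d, by rw [← hd]; rfl⟩
  have hreg := serre d R hd n h
  obtain ⟨s, hs1, hs2⟩ := (IsNoetherian.noetherian
    (maximalIdeal R)).exists_span_finset_card_eq_spanFinrank
  exact ⟨inferInstance, s, hs2, by rw [hs1]; exact hreg.spanFinrank_maximalIdeal⟩

end
end GGP
set_option linter.unusedSectionVars false
namespace GGP
open IsLocalRing

section
variable {R : Type u} [CommRing R] [IsNoetherianRing R] [IsLocalRing R]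

lemma exists_dim (R : Type u) [CommRing R] [IsNoetherianRing R] [IsLocalRing R] :
    ∃ d : ℕ, (maximalIdeal R).height = d := by
  obtain ⟨d, hd⟩ := ENat.ne_top_iff_exists.1 (Ideal.height_ne_top_of_isPrime (I := maximalIdeal R))
  exact ⟨d, hd.symm⟩

lemma exists_big_syz {n : ℕ} (hR : FID R R n) : ∃ K : ModuleCat.{u} R, GP R K ∧
    ∀ m, FPD R K m → GG.IsRegularLocal R := by
  obtain ⟨d, hd⟩ := exists_dim R
  obtain ⟨K, hK, hKe⟩ := exists_syz (R := R) d (R ⧸ maximalIdeal R)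
  refine ⟨K, ⟨hK, fun i hi => (hKe R i hi).1 (H4' hR hd _ (by omega) _)⟩, fun m hm => ?_⟩
  refine regular_of_FPD (n := m + d) fun Y _ _ i hi => ?_
  obtain ⟨j, rfl⟩ : ∃ j, i = j + d := ⟨i - d, by omega⟩
  exact (hKe Y j (by omega)).2 (hm Y j (by omega))

lemma regular_of_flat {n : ℕ} (hR : FID R R n)
    (h : ∀ M : ModuleCat.{u} R, GG.IsGorensteinFlat R M → Module.Flat R M) :
    GG.IsRegularLocal R := by
  obtain ⟨K, hK, hreg⟩ := exists_big_syz hR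
  have hfl := h K (GP.gorensteinFlat hR K hK)
  have := hK.1
  have : Module.FinitePresentation R K := Module.finitePresentation_of_finite R K
  exact hreg 0 (FPD.of_projective (Module.Flat.projective_of_finitePresentation) 0)

lemma regular_of_balanced {n : ℕ} (hR : FID R R n)
    (h : ∀ M : ModuleCat.{u} R, GG.IsBalancedBigCM R M → ∃ n, GG.fdLE R M n) :
    GG.IsRegularLocal R := by
  obtain ⟨K, hK, hreg⟩ := exists_big_syz hR
  have := hK.1
  rcases subsingleton_or_nontrivial K with hs | hs
  · exact hreg 0 fun Y _ _ i _ => XZ.of_subsingleton_left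
  · obtain ⟨m, hm⟩ := h K (GP.balanced hR K hK)
    exact hreg m (FPD.of_char m K (FID.of_idLE (idLE_char hm)))

lemma GP.xz_zero_of_FID {n : ℕ} (hR : FID R R n) {Y : Type u} [AddCommGroup Y] [Module R Y] {m : ℕ}
    (hY : FID R Y m) (k : ℕ) : ∀ (K : Type u) [AddCommGroup K] [Module R K], GP R K →
    ∀ i, 1 ≤ i → m < i + k → XZ (R := R) K Y i := by
  induction k with
  | zero => intro K _ _ _ i _ h; exact hY K i h
  | succ k ih =>
    intro K _ _ hK i hi h
    obtain ⟨K', hK', hs⟩ := GP.next hR K hK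
    exact (hs.xz_iff hi).1 (ih K' hK' (i + 1) (by omega) (by omega))

lemma GP.projective_of_FID {n : ℕ} (hR : FID R R n) {K : Type u} [AddCommGroup K] [Module R K] {m : ℕ}
    (hK : GP R K) (hY : FID R K m) : Module.Projective R K := by
  obtain ⟨K', hK', b, f, g, hf, hfg, hg⟩ := GP.next hR K hK
  obtain ⟨s, hs⟩ := (GP.xz_zero_of_FID hR hY m K' hK' 1 le_rfl (by omega)).extend hf hfg hg
    LinearMap.id
  exact Module.Projective.of_split f s hs

/-- the reduction of (iii) => (iv) -/
lemma regular_of_GG {n : ℕ} (hR : FID R R n)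
    (h : ∀ K : ModuleCat.{u} R, GP R K → ∃ m, FID R (K × R) m) :
    GG.IsRegularLocal R := by
  obtain ⟨K, hK, hreg⟩ := exists_big_syz hR
  obtain ⟨m, hm⟩ := h K hK
  have hK' : FID R K m := fun N _ _ i hi =>
    XZ.retract_right (LinearMap.inl R K R) (LinearMap.fst R K R) (by ext; rfl) (hm N i hi)
  exact hreg 0 (FPD.of_projective (GP.projective_of_FID hR hK hK') 0)

lemma GP.prod {K L : Type u} [AddCommGroup K] [Module R K] [AddCommGroup L] [Module R L]
    (hK : GP R K) (hL : GP R L) : GP R (K × L) := by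
  have := hK.1
  have := hL.1
  refine ⟨inferInstance, fun i hi => ?_⟩
  exact XS.contra_mid (f := LinearMap.inl R K L) (g := LinearMap.snd R K L) _
    LinearMap.inl_injective (by
      rintro ⟨a, b⟩
      constructor
      · rintro h; exact ⟨a, by ext <;> simp_all⟩
      · rintro ⟨x, hx⟩; simp_all [Prod.ext_iff]) LinearMap.snd_surjective
    (hK.2 i hi) (hL.2 i hi)

end
end GGP
set_option linter.unusedSectionVars false
namespace GGP
open IsLocalRing

section
variable {R : Type u} [CommRing R] [IsNoetherianRing R]

/-- support in heights at least `n`. -/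
def SupA (n : ℕ) (K : Type u) [AddCommGroup K] [Module R K] : Prop :=
  ∀ (k : K) (p : Ideal R), p.IsPrime → (∀ s, s • k = 0 → s ∈ p) → (n : ℕ∞) ≤ p.height

variable {K : Type u} [AddCommGroup K] [Module R K] {n : ℕ} {S : Set (PrimeSpectrum R)}

/-- localization map -/
noncomputable abbrev lm (q : PrimeSpectrum R) (K : Type u) [AddCommGroup K] [Module R K] :
    K →ₗ[R] LocalizedModule q.asIdeal.primeCompl K :=
  LocalizedModule.mkLinearMap q.asIdeal.primeCompl K

lemma loc_smul_cancel (q : PrimeSpectrum R) {a : R} (ha : a ∉ q.asIdeal)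
    {y : LocalizedModule q.asIdeal.primeCompl K} (h : a • y = 0) : y = 0 := by
  refine IsLocalizedModule.smul_injective (lm q K) (⟨a, ha⟩ : q.asIdeal.primeCompl) ?_
  change a • y = a • 0
  rw [h, smul_zero]

lemma SupA.le_of_ann (hK : SupA (R := R) n K) {q : PrimeSpectrum R} (hq : q.asIdeal.height = n)
    {y : LocalizedModule q.asIdeal.primeCompl K} {p : Ideal R} [hp : p.IsPrime]
    (h : ∀ s, s • y = 0 → s ∈ p) : q.asIdeal ≤ p := by
  obtain ⟨⟨k, t⟩, hkt⟩ := IsLocalizedModule.surj q.asIdeal.primeCompl (lm q K) y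
  have hd : Disjoint (((R ∙ k).annihilator : Ideal R) : Set R)
      ((q.asIdeal.primeCompl ⊔ p.primeCompl : Submonoid R) : Set R) := by
    rw [Set.disjoint_left]
    intro c hc hc'
    obtain ⟨a, ha, b, hb, rfl⟩ := Submonoid.mem_sup.1 hc'
    rw [SetLike.mem_coe, Submodule.mem_annihilator_span_singleton] at hc
    refine hb (h b (loc_smul_cancel q ha (loc_smul_cancel q t.2 ?_)))
    have h2 : (a * b) • lm q K k = 0 := by rw [← map_smul, hc, map_zero]
    rw [← hkt] at h2
    have h3 : (a * b) • ((t : R) • y) = 0 := h2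
    rw [smul_smul] at h3
    rw [smul_smul, smul_smul]
    convert h3 using 2
    ring
  obtain ⟨p', hp', h1, h2⟩ := Ideal.exists_le_prime_disjoint _ _ hd
  rw [Set.disjoint_left] at h2
  have hpq : p' ≤ q.asIdeal := fun x hx => by
    by_contra hxq
    exact h2 hx (Submonoid.mem_sup_left (show x ∈ q.asIdeal.primeCompl from hxq))
  have hpp : p' ≤ p := fun x hx => by
    by_contra hxq
    exact h2 hx (Submonoid.mem_sup_right (show x ∈ p.primeCompl from hxq))
  have h3 := hK k p' hp' fun s hs => h1 ((Submodule.mem_annihilator_span_singleton _ _).2 hs)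
  rw [← Ideal.eq_of_le_of_height_le p' hpq (hq ▸ h3)]
  exact hpp

lemma theta_apply (k : K) (q : S) : GG.thetaFull R S K k q = lm q.1 K k := rfl

lemma SupA.theta_mem (hK : SupA (R := R) n K) (hS : ∀ p, p ∈ S ↔ p.asIdeal.height = n) (k : K) :
    GG.thetaFull R S K k ∈ GG.finSupp R S K := by
  change Set.Finite _
  have hfin := Ideal.finite_minimalPrimes_of_isNoetherianRing R (R ∙ k).annihilator
  refine Set.Finite.of_finite_image (f := fun q : S => q.1.asIdeal) (hfin.subset ?_) ?_
  · rintro _ ⟨q, hq, rfl⟩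
    change GG.thetaFull R S K k q ≠ 0 at hq
    rw [theta_apply, Ne, IsLocalizedModule.eq_zero_iff q.1.asIdeal.primeCompl] at hq
    have hle : (R ∙ k).annihilator ≤ q.1.asIdeal := by
      intro x hx
      by_contra hxq
      exact hq ⟨⟨x, hxq⟩, (Submodule.mem_annihilator_span_singleton _ _).1 hx⟩
    refine ⟨⟨q.1.2, hle⟩, fun p' hp' hle' => ?_⟩
    have hp'p := hp'.1
    have h3 := hK k p' hp'.1 fun s hs =>
      hp'.2 ((Submodule.mem_annihilator_span_singleton _ _).2 hs)
    have := Ideal.eq_of_le_of_height_le p' hle' (((hS _).1 q.2) ▸ h3)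
    exact this.ge
  · intro a _ b _ hab
    exact Subtype.ext (PrimeSpectrum.ext hab)

lemma SupA.exists_kill (hK : SupA (R := R) n K) (hS : ∀ p, p ∈ S ↔ p.asIdeal.height = n)
    {p : Ideal R} [hp : p.IsPrime] {z : GG.locProd R S K} (hz : z ∈ GG.finSupp R S K)
    (h : ∀ q : S, q.1.asIdeal ≤ p → z q = 0) : ∃ s, s ∉ p ∧ s • z = 0 := by
  classical
  have h1 : ∀ q : S, ∃ s, s ∉ p ∧ s • z q = 0 := by
    intro q
    by_cases hq : q.1.asIdeal ≤ p
    · exact ⟨1, fun h => hp.ne_top ((Ideal.eq_top_iff_one _).2 h), by rw [h q hq, smul_zero]⟩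
    · by_contra hcon
      push Not at hcon
      exact hq (hK.le_of_ann ((hS _).1 q.2) fun s hs => by
        by_contra hsp; exact hcon s hsp hs)
  choose s hs1 hs2 using h1
  have hfin : {q : S | z q ≠ 0}.Finite := hz
  refine ⟨∏ q ∈ hfin.toFinset, s q, fun hmem => ?_, ?_⟩
  · obtain ⟨q, _, hq⟩ := (hp.prod_mem_iff).1 hmem
    exact hs1 q hq
  · funext q
    by_cases hq : z q = 0
    · simp [hq]
    · have : q ∈ hfin.toFinset := by simpa using hq
      rw [Pi.smul_apply, ← Finset.prod_erase_mul _ _ this, mul_smul, hs2, smul_zero]; rfl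

/-- theta into finSupp -/
noncomputable def theta' (hl : ∀ k : K, GG.thetaFull R S K k ∈ GG.finSupp R S K) :
    K →ₗ[R] GG.finSupp R S K := (GG.thetaFull R S K).codRestrict _ hl

/-- projection -/
noncomputable def piK (S : Set (PrimeSpectrum R)) (K : Type u) [AddCommGroup K] [Module R K] :
    GG.finSupp R S K →ₗ[R] GG.nextKType R S K := Submodule.mkQ _

lemma piK_surj : Function.Surjective (piK S K) := Submodule.mkQ_surjective _

lemma theta_piK_exact (hl : ∀ k : K, GG.thetaFull R S K k ∈ GG.finSupp R S K) :
    Function.Exact (theta' hl) (piK S K) := by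
  rw [LinearMap.exact_iff]
  rw [piK, Submodule.ker_mkQ]
  ext x
  rw [Submodule.mem_comap]
  constructor
  · rintro ⟨k, hk⟩; exact ⟨k, Subtype.ext hk⟩
  · rintro ⟨k, rfl⟩; exact ⟨k, rfl⟩

lemma SupA.next (hK : SupA (R := R) n K) (hS : ∀ p, p ∈ S ↔ p.asIdeal.height = n) :
    SupA (R := R) (n + 1) (GG.nextKType R S K) := by
  intro c p hp h
  obtain ⟨x, rfl⟩ := piK_surj c
  have hl := hK.theta_mem hS
  by_contra hcon
  rw [not_le] at hcon
  have hle : p.height ≤ n := by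
    rw [Nat.cast_add_one] at hcon
    exact Order.le_of_lt_add_one hcon
  obtain ⟨k, t, ht, hkt⟩ : ∃ (k : K) (t : R), t ∉ p ∧ ∀ q : S, q.1.asIdeal ≤ p →
      (t • x.1 - GG.thetaFull R S K k) q = 0 := by
    have heq : ∀ q : S, q.1.asIdeal ≤ p → q.1.asIdeal = p := fun q hq =>
      Ideal.eq_of_le_of_height_le _ hq (by rw [(hS _).1 q.2]; exact hle)
    by_cases hpS : (⟨p, hp⟩ : PrimeSpectrum R) ∈ S
    · let q₀ : S := ⟨⟨p, hp⟩, hpS⟩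
      obtain ⟨⟨k, t⟩, hkt⟩ := IsLocalizedModule.surj q₀.1.asIdeal.primeCompl (lm q₀.1 K) (x.1 q₀)
      refine ⟨k, t, t.2, fun q hq => ?_⟩
      have : q = q₀ := Subtype.ext (PrimeSpectrum.ext (heq q hq))
      subst this
      rw [Pi.sub_apply, theta_apply]
      exact sub_eq_zero.2 hkt
    · refine ⟨0, 1, fun h => hp.ne_top ((Ideal.eq_top_iff_one _).2 h), fun q hq => ?_⟩
      exact absurd (by have := heq q hq; subst this; exact q.2) hpS
  obtain ⟨s, hs, hs'⟩ := hK.exists_kill hS (p := p) (Submodule.sub_mem _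
    (Submodule.smul_mem _ t x.2) (hl k)) hkt
  have hx : (s * t) • x = theta' hl (s • k) := by
    refine Subtype.ext ?_
    change (s * t) • x.1 = GG.thetaFull R S K (s • k)
    rw [map_smul, mul_smul]
    rw [smul_sub] at hs'
    exact sub_eq_zero.1 hs'
  have : (s * t) ∈ p := h _ (by
    rw [← map_smul, hx]; exact (theta_piK_exact hl).apply_apply_eq_zero _)
  rcases hp.mem_or_mem this with h | h
  · exact hs h
  · exact ht h

lemma SupA.theta_injective (hK : SupA (R := R) n K) (hS : ∀ p, p ∈ S ↔ p.asIdeal.height = n)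
    (hb : ∀ q : Ideal R, q.IsPrime → (n : ℕ∞) < q.height → XZ (R := R) (R ⧸ q) K 0) :
    Function.Injective (GG.thetaFull R S K) := by
  rw [← LinearMap.ker_eq_bot]
  by_contra hne
  obtain ⟨k, hk, hk0⟩ := Submodule.exists_mem_ne_zero_of_ne_bot hne
  obtain ⟨q, hq, -⟩ := exists_le_isAssociatedPrime_of_isNoetherianRing R
    (⟨k, hk⟩ : LinearMap.ker (GG.thetaFull R S K)) (by simpa using hk0)
  have hqp := hq.isPrime
  obtain ⟨f, hf⟩ := (isAssociatedPrime_iff_exists_injective_linearMap _ _).1 hq |>.2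
  have hann : ∀ s : R, s • (f 1 : K) = 0 → s ∈ q := by
    intro s hs
    have : f (s • 1) = 0 := by rw [map_smul]; exact Subtype.ext hs
    rw [map_eq_zero_iff f hf] at this
    rw [← Ideal.Quotient.eq_zero_iff_mem]
    simpa [Algebra.smul_def] using this
  have h1 := hK _ q hqp hann
  rcases h1.lt_or_eq with h1 | h1
  · have := XZ_zero_iff.1 (hb q hqp h1) ((LinearMap.ker (GG.thetaFull R S K)).subtype ∘ₗ f)
    have h0 := LinearMap.congr_fun this 1
    have h2 : (f 1 : K) = 0 := h0
    exact hqp.ne_top ((Ideal.eq_top_iff_one _).2 (hann 1 (by rw [h2, smul_zero])))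
  · have hqS : (⟨q, hqp⟩ : PrimeSpectrum R) ∈ S := (hS _).2 h1.symm
    have h2 : GG.thetaFull R S K (f 1 : K) = 0 := (f 1).2
    have h3 := congrFun h2 ⟨_, hqS⟩
    rw [theta_apply] at h3
    obtain ⟨s, hs⟩ := (IsLocalizedModule.eq_zero_iff q.primeCompl (lm ⟨q, hqp⟩ K)).1 h3
    exact s.2 (hann _ hs)

lemma finSupp_hom_zero (hS : ∀ p, p ∈ S ↔ p.asIdeal.height = n) (q : Ideal R) (hq : (n : ℕ∞) < q.height) :
    XZ (R := R) (R ⧸ q) (GG.finSupp R S K) 0 := by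
  rw [XZ_zero_iff]
  intro f
  ext1; ext1
  refine Subtype.ext (funext fun p => ?_)
  have hnle : ¬ q ≤ p.1.asIdeal := fun h => by
    have := Ideal.height_mono h
    rw [(hS _).1 p.2] at this
    exact absurd this (not_le.2 hq)
  obtain ⟨a, ha, hap⟩ := SetLike.not_le_iff_exists.1 hnle
  refine loc_smul_cancel p.1 hap ?_
  have h1 : a • f 1 = 0 := by
    rw [← map_smul]
    have : a • (1 : R ⧸ q) = 0 := by
      rw [Algebra.smul_def, mul_one]; exact Ideal.Quotient.eq_zero_iff_mem.2 ha
    rw [this, map_zero]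
  exact congrFun (congrArg Subtype.val h1) p

end
end GGP
set_option linter.unusedSectionVars false
namespace GGP
open IsLocalRing

section
open CategoryTheory CategoryTheory.Abelian
variable {R : Type u} [CommRing R] (S : Submonoid R) {A B C N Y : Type u} [AddCommGroup A]
    [AddCommGroup B] [AddCommGroup C]
    [Module R A] [Module R B] [Module R C] [AddCommGroup N] [Module R N] [AddCommGroup Y]
    [Module R Y] {f : A →ₗ[R] B} {g : B →ₗ[R] C}
    (hf : Function.Injective f) (hfg : Function.Exact f g) (hg : Function.Surjective g)

include hf hfg hg in
lemma XS.extend (h : XS S C Y 1) (φ : A →ₗ[R] Y) : ∃ s ∈ S, ∃ ψ : B →ₗ[R] Y, ψ.comp f = s • φ := by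
  obtain ⟨s, hs, h0⟩ := h ((shortExact_of hf hfg hg).extClass.comp
    (Ext.mk₀ (ModuleCat.ofHom φ)) (add_comm 1 0))
  rw [← Ext.comp_smul] at h0
  refine ⟨s, hs, ?_⟩
  obtain ⟨x, hx⟩ := Ext.contravariant_sequence_exact₁ (shortExact_of hf hfg hg) _ _ (add_comm 1 0) h0
  obtain ⟨ψ, rfl⟩ := Ext.homEquiv₀.symm.surjective x
  refine ⟨ψ.hom, ?_⟩
  change (Ext.mk₀ _).comp (Ext.mk₀ ψ) _ = _ at hx
  rw [Ext.mk₀_comp_mk₀, ← Ext.mk₀_smul] at hx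
  have := Ext.homEquiv₀.symm.injective hx
  exact congrArg ModuleCat.Hom.hom this
end

section
variable {R : Type u} [CommRing R] [IsNoetherianRing R]
variable {K : Type u} [AddCommGroup K] [Module R K] {n : ℕ} {S : Set (PrimeSpectrum R)}

lemma loc_baer (q : PrimeSpectrum R)
    (h : ∀ I : Ideal R, XS q.asIdeal.primeCompl (R ⧸ I) K 1) (I : Ideal R)
    (φ : I →ₗ[R] LocalizedModule q.asIdeal.primeCompl K) :
    ∃ y : LocalizedModule q.asIdeal.primeCompl K, ∀ a : I, φ a = (a : R) • y := by
  have : Module.FinitePresentation R I := Module.finitePresentation_of_finite R I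
  obtain ⟨ψ, s, hψ⟩ := Module.FinitePresentation.exists_lift_of_isLocalizedModule
    q.asIdeal.primeCompl (lm q K) φ
  obtain ⟨t, ht, χ, hχ⟩ := (h I).extend _ (f := I.subtype) (g := Submodule.mkQ I)
    (Submodule.injective_subtype _) (LinearMap.exact_subtype_mkQ I) (Submodule.mkQ_surjective _) ψ
  refine ⟨IsLocalizedModule.mk' (lm q K) (χ 1) (⟨t, ht⟩ * s), fun a => ?_⟩
  refine IsLocalizedModule.smul_injective (lm q K) (⟨t, ht⟩ * s) ?_
  change (⟨t, ht⟩ * s) • _ = (⟨t, ht⟩ * s) • _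
  rw [smul_comm (_ : q.asIdeal.primeCompl) (a : R), IsLocalizedModule.mk'_cancel',
    ← (lm q K).map_smul, ← χ.map_smul, smul_eq_mul, mul_one]
  have h1 : χ (a : R) = t • ψ a := LinearMap.congr_fun hχ a
  have h2 : lm q K (ψ a) = s • φ a := LinearMap.congr_fun hψ a
  rw [h1, map_smul, h2, mul_smul]
  rfl

lemma finSupp_injective
    (h : ∀ q ∈ S, ∀ I : Ideal R, XS q.asIdeal.primeCompl (R ⧸ I) K 1) :
    Module.Injective R (GG.finSupp R S K) := by
  classical
  refine Module.Baer.injective ?_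
  intro I φ
  have hIfg : (⊤ : Submodule R I).FG := Module.Finite.fg_top
  obtain ⟨T, hT⟩ := hIfg
  -- finite support bound
  let U : Set S := ⋃ a ∈ T, {q : S | (φ a).1 q ≠ 0}
  have hU : U.Finite := Set.Finite.biUnion T.finite_toSet fun a _ => (φ a).2
  have hzero : ∀ q ∉ U, ∀ a : I, (φ a).1 q = 0 := by
    intro q hq a
    let π : GG.finSupp R S K →ₗ[R] LocalizedModule q.1.asIdeal.primeCompl K :=
      LinearMap.proj q ∘ₗ (GG.finSupp R S K).subtype
    have : (⊤ : Submodule R I) ≤ LinearMap.ker (π ∘ₗ φ) := by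
      rw [← hT, Submodule.span_le]
      intro b hb
      by_contra hne
      exact hq (Set.mem_biUnion (Finset.mem_coe.2 hb) hne)
    exact this (Submodule.mem_top : a ∈ ⊤)
  have hext : ∀ q : S, ∃ y : LocalizedModule q.1.asIdeal.primeCompl K, ∀ a : I,
      (φ a).1 q = (a : R) • y := fun q =>
    loc_baer q.1 (h q.1 q.2) I (LinearMap.proj q ∘ₗ (GG.finSupp R S K).subtype ∘ₗ φ)
  choose y hy using hext
  let z : GG.locProd R S K := fun q => if q ∈ U then y q else 0
  have hz : z ∈ GG.finSupp R S K := by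
    refine hU.subset fun q hq => ?_
    by_contra hqU
    exact hq (if_neg hqU)
  refine ⟨LinearMap.toSpanSingleton R _ ⟨z, hz⟩, fun x hx => ?_⟩
  refine Subtype.ext (funext fun q => ?_)
  change x • z q = (φ ⟨x, hx⟩).1 q
  by_cases hq : q ∈ U
  · rw [hy q ⟨x, hx⟩]; simp only [z, if_pos hq]
  · rw [hzero q hq]; simp only [z, if_neg hq, smul_zero]

end

section
variable {R : Type u} [CommRing R] [IsNoetherianRing R]

/-- The inductive state of the Cousin complex. -/
structure St (n : ℕ) (K : Type u) [AddCommGroup K] [Module R K] : Prop where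
  a : SupA (R := R) n K
  b : ∀ q : Ideal R, q.IsPrime → ∀ i : ℕ, ((n + i : ℕ) : ℕ∞) < q.height → XZ (R := R) (R ⧸ q) K i
  c : ∀ (p : Ideal R) [p.IsPrime] (h : ℕ), p.height = h → ∀ j, 1 ≤ j → h < n + j →
    ∀ I : Ideal R, XS p.primeCompl (R ⧸ I) K j

variable {K : Type u} [AddCommGroup K] [Module R K] {n : ℕ} {S : Set (PrimeSpectrum R)}

lemma St.inj (h : St (R := R) n K) (hS : ∀ p, p ∈ S ↔ p.asIdeal.height = n) :
    Module.Injective R (GG.finSupp R S K) :=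
  finSupp_injective fun q hq I => h.c q.asIdeal n ((hS _).1 hq) 1 le_rfl (by omega) I

lemma St.theta_injective (h : St (R := R) n K) (hS : ∀ p, p ∈ S ↔ p.asIdeal.height = n) :
    Function.Injective (GG.thetaFull R S K) :=
  h.a.theta_injective hS fun q hq hlt => h.b q hq 0 (by simpa using hlt)

lemma St.theta'_injective (h : St (R := R) n K) (hS : ∀ p, p ∈ S ↔ p.asIdeal.height = n) :
    Function.Injective (theta' (h.a.theta_mem hS)) := fun x y hxy =>
  h.theta_injective hS (congrArg Subtype.val hxy)

lemma St.next (h : St (R := R) n K) (hS : ∀ p, p ∈ S ↔ p.asIdeal.height = n) :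
    St (R := R) (n + 1) (GG.nextKType R S K) := by
  have hinj := h.inj hS
  have hl := h.a.theta_mem hS
  refine ⟨h.a.next hS, ?_, ?_⟩
  · intro q hq i hi
    refine XS.cov_right _ (h.theta'_injective hS) (theta_piK_exact hl) piK_surj ?_
      (h.b q hq (i + 1) (by convert hi using 2; omega))
    rcases Nat.eq_zero_or_pos i with rfl | hi0
    · exact finSupp_hom_zero hS q (lt_of_le_of_lt (by exact_mod_cast (by omega)) hi)
    · exact XZ.of_injective hi0
  · intro p _ ht hp j hj hlt I
    exact XS.cov_right _ (h.theta'_injective hS) (theta_piK_exact hl) piK_surj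
      (XZ.xs _ (XZ.of_injective hj)) (h.c p ht hp (j + 1) (by omega) (by omega) I)

lemma St.self [IsLocalRing R] {m : ℕ} (hR : FID R R m) : St (R := R) 0 R where
  a := fun _ _ _ _ => by simp
  b := fun q hq i hi => H3 hR q hq i (by simpa using hi)
  c := fun p _ h hp j _ hlt I => H4 hR p hp j (by omega) _

end
end GGP
set_option linter.unusedSectionVars false
namespace GGP
open IsLocalRing TensorProduct

section
variable {R : Type u} [CommRing R] [IsNoetherianRing R]
variable (S : Set (PrimeSpectrum R)) (K : Type u) [AddCommGroup K] [Module R K]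

open Classical in
noncomputable def dsMap : (DirectSum S fun p => LocalizedModule p.1.asIdeal.primeCompl K) →ₗ[R]
    GG.finSupp R S K :=
  LinearMap.codRestrict _ (DFinsupp.coeFnLinearMap R) fun x => by
    change Set.Finite _
    refine (DFinsupp.support x).finite_toSet.subset fun p hp => ?_
    have hp' : x p ≠ 0 := hp
    simpa using hp'

lemma dsMap_apply (x) (p : S) : (dsMap S K x).1 p = x p := rfl

lemma dsMap_bij : Function.Bijective (dsMap S K) := by
  classical
  constructor
  · intro x y h
    exact DFinsupp.ext fun p => congrFun (congrArg Subtype.val h) p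
  · intro z
    have hz : {p : S | z.1 p ≠ 0}.Finite := z.2
    refine ⟨DFinsupp.mk hz.toFinset fun p => z.1 p.1, ?_⟩
    refine Subtype.ext (funext fun p => ?_)
    rw [dsMap_apply]
    rw [DFinsupp.mk_apply]
    split_ifs with h
    · rfl
    · by_contra hne
      exact h (by simpa using Ne.symm hne)

noncomputable def dsEquiv : (DirectSum S fun p => LocalizedModule p.1.asIdeal.primeCompl K) ≃ₗ[R]
    GG.finSupp R S K := LinearEquiv.ofBijective (dsMap S K) (dsMap_bij S K)

lemma dsEquiv_apply (x) (p : S) : (dsEquiv S K x).1 p = x p := rfl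

lemma dsEquiv_symm_apply (x) (p : S) : (dsEquiv S K).symm x p = x.1 p := by
  obtain ⟨y, rfl⟩ := (dsEquiv S K).surjective x
  rw [LinearEquiv.symm_apply_apply, dsEquiv_apply]

variable {S K}
variable {M K' : Type u} [AddCommGroup M] [Module R M] [AddCommGroup K'] [Module R K']

lemma exists_beta (e : K' ≃ₗ[R] K ⊗[R] M) (p : PrimeSpectrum R) :
    ∃ β : (LocalizedModule p.asIdeal.primeCompl K) ⊗[R] M ≃ₗ[R]
      LocalizedModule p.asIdeal.primeCompl K', ∀ (k : K) (m : M),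
      β (lm p K k ⊗ₜ m) = lm p K' (e.symm (k ⊗ₜ m)) := by
  have h1 : IsLocalizedModule p.asIdeal.primeCompl (LinearMap.rTensor M (lm p K)) :=
    IsLocalizedModule.rTensor (R := R) (A := R) (N := M) p.asIdeal.primeCompl (lm p K)
  have h2 : IsLocalizedModule p.asIdeal.primeCompl (lm p K' ∘ₗ e.symm.toLinearMap) :=
    IsLocalizedModule.of_linearEquiv_right _ _ _
  refine ⟨IsLocalizedModule.linearEquiv p.asIdeal.primeCompl (LinearMap.rTensor M (lm p K))
    (lm p K' ∘ₗ e.symm.toLinearMap), fun k m => ?_⟩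
  exact IsLocalizedModule.linearEquiv_apply p.asIdeal.primeCompl (LinearMap.rTensor M (lm p K))
    (lm p K' ∘ₗ e.symm.toLinearMap) (k ⊗ₜ m)

lemma exists_Phi (S : Set (PrimeSpectrum R)) (e : K' ≃ₗ[R] K ⊗[R] M) :
    ∃ Φ : (GG.finSupp R S K) ⊗[R] M ≃ₗ[R] GG.finSupp R S K',
      ∀ (x : GG.finSupp R S K) (k : K) (m : M), x.1 = GG.thetaFull R S K k →
        (Φ (x ⊗ₜ m)).1 = GG.thetaFull R S K' (e.symm (k ⊗ₜ m)) := by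
  classical
  choose β hβ using exists_beta (M := M) e
  let Φ := (TensorProduct.congr (dsEquiv S K).symm (LinearEquiv.refl R M)) ≪≫ₗ
    TensorProduct.directSumLeft R R (fun p : S => LocalizedModule p.1.asIdeal.primeCompl K) M ≪≫ₗ
    (DFinsupp.mapRange.linearEquiv fun p : S => β p.1) ≪≫ₗ dsEquiv S K'
  refine ⟨Φ, fun x k m hx => funext fun p => ?_⟩
  have h1 : (Φ (x ⊗ₜ m)).1 p = β p.1 (TensorProduct.directSumLeft R R
      (fun p : S => LocalizedModule p.1.asIdeal.primeCompl K) M ((dsEquiv S K).symm x ⊗ₜ m) p) := rfl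
  rw [h1, TensorProduct.directSumLeft_tmul, dsEquiv_symm_apply, hx, theta_apply, theta_apply, hβ]

/-- Transfer of one Cousin step along tensor product. -/
lemma tensor_step (hl : ∀ k : K, GG.thetaFull R S K k ∈ GG.finSupp R S K)
    (hinj : Function.Injective (theta' hl)) (hPA : PA R (GG.nextKType R S K)) (hM : GP R M)
    (e : K' ≃ₗ[R] K ⊗[R] M) :
    (∀ k : K', GG.thetaFull R S K' k ∈ GG.finSupp R S K') ∧
    Function.Injective (GG.thetaFull R S K') ∧
    Nonempty ((GG.finSupp R S K) ⊗[R] M ≃ₗ[R] GG.finSupp R S K') ∧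
    Nonempty (GG.nextKType R S K' ≃ₗ[R] (GG.nextKType R S K) ⊗[R] M) := by
  obtain ⟨Φ, hΦ⟩ := exists_Phi (M := M) S e
  have hcomm : ∀ t : K ⊗[R] M, (Φ (LinearMap.rTensor M (theta' hl) t)).1 =
      GG.thetaFull R S K' (e.symm t) := by
    intro t
    induction t with
    | zero => simp
    | add a b ha hb => simp only [map_add, ← ha, ← hb]; rfl
    | tmul k m => exact hΦ _ k m rfl
  have hcomm' : ∀ k : K', GG.thetaFull R S K' k =
      (Φ (LinearMap.rTensor M (theta' hl) (e k))).1 := fun k => by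
    rw [hcomm, LinearEquiv.symm_apply_apply]
  have hl' : ∀ k : K', GG.thetaFull R S K' k ∈ GG.finSupp R S K' := fun k => by
    rw [hcomm']; exact Subtype.prop _
  have hti := PA.tensor_injective hinj (theta_piK_exact hl) piK_surj hPA M hM
  refine ⟨hl', ?_, ⟨Φ⟩, ?_⟩
  · intro x y hxy
    rw [hcomm', hcomm'] at hxy
    exact e.injective (hti (Φ.injective (Subtype.ext hxy)))
  · let g : GG.finSupp R S K' →ₗ[R] (GG.nextKType R S K) ⊗[R] M :=
      LinearMap.rTensor M (piK S K) ∘ₗ Φ.symm.toLinearMap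
    have hg : Function.Surjective g :=
      (LinearMap.rTensor_surjective M piK_surj).comp Φ.symm.surjective
    have hex := rTensor_exact M (theta_piK_exact hl) piK_surj
    have hker : Submodule.comap (GG.finSupp R S K').subtype
        (LinearMap.range (GG.thetaFull R S K')) = LinearMap.ker g := by
      ext z
      constructor
      · rintro ⟨k, hk⟩
        have : z = Φ (LinearMap.rTensor M (theta' hl) (e k)) := by
          refine Subtype.ext ?_
          rw [← hcomm']; exact hk.symm
        change LinearMap.rTensor M (piK S K) (Φ.symm z) = 0
        rw [this, LinearEquiv.symm_apply_apply]
        exact hex.apply_apply_eq_zero _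
      · intro hz
        obtain ⟨t, ht⟩ := (hex _).1 (show LinearMap.rTensor M (piK S K) (Φ.symm z) = 0 from hz)
        refine ⟨e.symm t, ?_⟩
        rw [← hcomm, ht, LinearEquiv.apply_symm_apply]
        rfl
    exact ⟨(Submodule.quotEquivOfEq _ _ hker) ≪≫ₗ LinearMap.quotKerEquivOfSurjective g hg⟩

end
end GGP
set_option linter.unusedSectionVars false
namespace GGP
open IsLocalRing TensorProduct

section
variable (R : Type u) [CommRing R] 

/-- height filtration of the ring -/
def HF : ℕ → Set (PrimeSpectrum R) := fun n => {p | (n : ℕ∞) ≤ p.asIdeal.height}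

lemma heightFiltration_eq (M : Type u) [AddCommGroup M] [Module R M]
    (h : Module.support R M = Set.univ) : GG.heightFiltration R M = HF R := by
  funext i
  ext p
  have hp : p ∈ Module.support R M := by rw [h]; trivial
  have key : GG.htM R M p = p.asIdeal.height := by
    rw [GG.htM, iSup_pos hp, PrimeSpectrum.height_eq_orderHeight]
    let e : ↥(Module.support R M) ≃o PrimeSpectrum R :=
      { toFun := Subtype.val
        invFun := fun q => ⟨q, by rw [h]; trivial⟩
        left_inv := fun _ => rfl
        right_inv := fun _ => rfl
        map_rel_iff' := Iff.rfl }
    exact (Order.height_orderIso e ⟨p, hp⟩).symm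
  change (p ∈ Module.support R M ∧ (i : ℕ∞) ≤ GG.htM R M p) ↔ _
  rw [key]
  exact ⟨fun h => h.2, fun h => ⟨hp, h⟩⟩

lemma HF_mem (n : ℕ) (p : PrimeSpectrum R) :
    p ∈ HF R n \ HF R (n + 1) ↔ p.asIdeal.height = n := by
  change ((n : ℕ∞) ≤ p.asIdeal.height ∧ ¬ (((n + 1 : ℕ) : ℕ∞) ≤ p.asIdeal.height)) ↔ _
  rw [not_le, Nat.cast_add_one]
  constructor
  · rintro ⟨h1, h2⟩
    exact le_antisymm (Order.le_of_lt_add_one h2) h1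
  · intro h
    rw [h]
    exact ⟨le_rfl, by exact_mod_cast Nat.lt_succ_self n⟩

variable [IsNoetherianRing R] [IsLocalRing R]
variable {R} {n : ℕ} (hR : FID R R n)

include hR in
lemma cousin_St (i : ℕ) : St (R := R) i (GG.cousinK R (HF R) (ModuleCat.of R R) i) := by
  induction i with
  | zero => exact St.self hR
  | succ i ih => exact ih.next (HF_mem R i)

lemma SupA.subsingleton {K : Type u} [AddCommGroup K] [Module R K] {i d : ℕ}
    (hd : (maximalIdeal R).height = d) (hi : d < i) (h : SupA (R := R) i K) : Subsingleton K := by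
  refine subsingleton_of_forall_eq 0 fun k => ?_
  by_contra hk
  have := h k (maximalIdeal R) inferInstance fun s hs => by
    rw [mem_maximalIdeal, mem_nonunits_iff]
    intro hu
    exact hk ((hu.smul_eq_zero).1 hs)
  rw [hd] at this
  have : i ≤ d := by exact_mod_cast this
  omega

include hR in
lemma cousin_PA (i : ℕ) : PA R (GG.cousinK R (HF R) (ModuleCat.of R R) i) := by
  obtain ⟨d, hd⟩ := exists_dim R
  have key : ∀ k i, d < i + k → PA R (GG.cousinK R (HF R) (ModuleCat.of R R) i) := by
    intro k
    induction k with
    | zero =>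
      intro i hi
      have := (cousin_St hR i).a.subsingleton hd hi
      exact PA.of_subsingleton
    | succ k ih =>
      intro i hi
      have hs := cousin_St hR i
      have hS := HF_mem R i
      exact PA.of_ses (hs.theta'_injective hS) (theta_piK_exact (hs.a.theta_mem hS)) piK_surj
        (ih (i + 1) (by omega)) (PA.of_injective (hs.inj hS))
  exact key d.succ i (by omega)

include hR in
lemma cousin_equiv (M : ModuleCat.{u} R) (hM : GP R M) (i : ℕ) :
    Nonempty (GG.cousinK R (HF R) M i ≃ₗ[R]
      (GG.cousinK R (HF R) (ModuleCat.of R R) i) ⊗[R] M) := by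
  induction i with
  | zero => exact ⟨(TensorProduct.lid R M).symm⟩
  | succ i ih =>
    obtain ⟨e⟩ := ih
    have hs := cousin_St hR i
    have hS := HF_mem R i
    exact (tensor_step (hs.a.theta_mem hS) (hs.theta'_injective hS) (cousin_PA hR (i + 1)) hM e).2.2.2

lemma gi_of_equiv {A B : Type u} [AddCommGroup A] [Module R A] [AddCommGroup B] [Module R B]
    (e : A ≃ₗ[R] B) (h : GG.IsGorensteinInjective R A) : GG.IsGorensteinInjective R B := by
  obtain ⟨X, D, h1, h2, h3, ⟨e'⟩⟩ := h
  exact ⟨X, D, h1, h2, h3, ⟨e.symm ≪≫ₗ e'⟩⟩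

include hR in
lemma cousin_facts (M : ModuleCat.{u} R) (hM : GP R M) (i : ℕ) :
    (∀ k, GG.cousinTheta R (HF R) M i k ∈
      GG.finSupp R (HF R i \ HF R (i + 1)) (GG.cousinK R (HF R) M i)) ∧
    Function.Injective (GG.cousinTheta R (HF R) M i) ∧
    GG.IsGorensteinInjective R (GG.cousinC R (HF R) M i) := by
  obtain ⟨e⟩ := cousin_equiv hR M hM i
  have hs := cousin_St hR i
  have hS := HF_mem R i
  obtain ⟨h1, h2, ⟨Φ⟩, -⟩ :=
    tensor_step (hs.a.theta_mem hS) (hs.theta'_injective hS) (cousin_PA hR (i + 1)) hM e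
  exact ⟨h1, h2, gi_of_equiv Φ (GP.gorensteinInjective hR M hM _ (hs.inj hS))⟩

include hR in
lemma cousin_resolves (M : ModuleCat.{u} R) (hM : GP R M) :
    GG.CousinResolves R (HF R) M (fun N => GG.IsGorensteinInjective R N) := by
  refine ⟨fun i => ?_, (cousin_facts hR M hM 0).2.1, fun i => ?_, fun i => (cousin_facts hR M hM i).2.2⟩
  · rintro _ ⟨k, rfl⟩
    exact (cousin_facts hR M hM i).1 k
  · have hinj := (cousin_facts hR M hM (i + 1)).2.1
    exact (LinearMap.ker_comp_of_ker_eq_bot _ (LinearMap.ker_eq_bot.2 hinj)).trans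
      (Submodule.ker_mkQ _)

include hR in
lemma cousin_FID (M : ModuleCat.{u} R) (hM : GP R M)
    (h : ∀ i, Module.Injective R (GG.cousinC R (HF R) M i)) : ∃ m, FID R M m := by
  obtain ⟨d, hd⟩ := exists_dim R
  have key : ∀ k i, d < i + k → FID R (GG.cousinK R (HF R) M i) k := by
    intro k
    induction k with
    | zero =>
      intro i hi N _ _ j _
      have := (cousin_St hR i).a.subsingleton hd hi
      obtain ⟨e⟩ := cousin_equiv hR M hM i
      have := e.toEquiv.subsingleton
      exact XZ.of_subsingleton_right
    | succ k ih =>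
      intro i hi N _ _ j hj
      obtain ⟨h1, h2, -⟩ := cousin_facts hR M hM i
      have hC := h i
      obtain ⟨j, rfl⟩ : ∃ j', j = j' + 1 := ⟨j - 1, by omega⟩
      exact XS.cov_left _ (f := theta' h1) (g := piK _ _)
        (fun x y hxy => h2 (congrArg Subtype.val hxy)) (theta_piK_exact h1) piK_surj
        (ih (i + 1) (by omega) N j (by omega)) (XZ.of_injective (by omega))
  exact ⟨d + 1, key (d + 1) 0 (by omega)⟩

include hR in
lemma regular_of_GGorenstein
    (h : ∀ M : ModuleCat.{u} R, GG.IsGGorenstein R M → GG.IsGorensteinModule R M) :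
    GG.IsRegularLocal R := by
  refine regular_of_GG hR fun K hK => ?_
  have hM : GP R (K × R) := hK.prod GP.self
  have hfin := hM.1
  have hsupp : Module.support R (K × R) = Set.univ := by
    refine Set.eq_univ_of_forall fun p => ?_
    rw [Module.mem_support_iff']
    refine ⟨(0, 1), fun r hr h0 => hr ?_⟩
    have : r = 0 := by simpa using congrArg Prod.snd h0
    rw [this]; exact zero_mem _
  have hF := heightFiltration_eq R (K × R) hsupp
  have hGG : GG.IsGGorenstein R (ModuleCat.of R (K × R)) := by
    refine ⟨⟨(0, 1), fun h0 => one_ne_zero (congrArg Prod.snd h0 : (1 : R) = 0)⟩, hfin, ?_⟩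
    change GG.CousinResolves R (GG.heightFiltration R (K × R)) _ _
    rw [hF]
    exact cousin_resolves hR _ hM
  obtain ⟨-, -, hc⟩ := h _ hGG
  change GG.CousinResolves R (GG.heightFiltration R (K × R)) _ _ at hc
  rw [hF] at hc
  exact cousin_FID hR (ModuleCat.of R (K × R)) hM hc.2.2.2

end
end GGP

open GG in
/-- Characterizations of regular local rings among Gorenstein local rings. -/
theorem stmt19 (R : Type u) [CommRing R] [IsLocalRing R]
    (hG : IsGorensteinLocalRing R) :
    ((∀ M : ModuleCat.{u} R, IsGorensteinFlat R M → Module.Flat R M) ↔ IsRegularLocal R) ∧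
    ((∀ M : ModuleCat.{u} R, IsBalancedBigCM R M → ∃ n, fdLE R M n) ↔ IsRegularLocal R) ∧
    ((∀ M : ModuleCat.{u} R, IsGGorenstein R M → IsGorensteinModule R M) ↔
      IsRegularLocal R) := by
  obtain ⟨hN, n, hn⟩ := hG
  have hR := GGP.FID.of_idLE hn
  refine ⟨⟨GGP.regular_of_flat hR, fun h M hM => ?_⟩,
    ⟨GGP.regular_of_balanced hR, fun h M hM => ?_⟩,
    ⟨GGP.regular_of_GGorenstein hR, fun h M hM => ?_⟩⟩
  · obtain ⟨d, hd⟩ := GGP.GD.of_regular hR h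
    exact hd.gorensteinFlat M hM
  · obtain ⟨d, hd⟩ := GGP.GD.of_regular hR h
    exact ⟨d, hd.fd M⟩
  · obtain ⟨d, hd⟩ := GGP.GD.of_regular hR h
    obtain ⟨h0, hfin, h1, h2, h3, h4⟩ := hM
    exact ⟨h0, hfin, h1, h2, h3, fun i => hd.gorensteinInjective _ (h4 i)⟩
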